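/- Let S be a maximal star decomposition of a cyclic polygon P with respect to a set of diagonals D. Then for every diagonal e ∈ D there exists exactly one diagonal f ∉ D such that P has a maximal star decomposition with respect to (D \ {e}) ∪ {f}. -/

import Mathlib

open Complex
open scoped Classical

noncomputable section

/-- The anticlockwise arc displacement from `u` to `v` on the unit circle, lying in `(0, 2π]`
(equal to `2π` when `v = u`). -/
def posArc (u v : ℂ) : ℝ :=
  if 0 < Complex.arg (v / u) then Complex.arg (v / u) else Complex.arg (v / u) + 2 * Real.pi

/-- `u, v, w` occur in anticlockwise order on the circle. -/
def ACW (u v w : ℂ) : Prop :=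
  u ≠ v ∧ v ≠ w ∧ u ≠ w ∧ posArc u v < posArc u w

/-- The open anticlockwise arc from `u` to `v`. -/
def arcOO (u v : ℂ) : Set ℂ := {x | x ≠ u ∧ x ≠ v ∧ posArc u x < posArc u v}

/-- The anticlockwise arc from `u` to `v`, open at `u` and closed at `v`. -/
def arcOC (u v : ℂ) : Set ℂ := {x | x ≠ u ∧ (x = v ∨ posArc u x < posArc u v)}

/-- The closed anticlockwise arc from `u` to `v`. -/
def arcCC (u v : ℂ) : Set ℂ := {x | x = u ∨ x = v ∨ (x ≠ u ∧ posArc u x < posArc u v)}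

/-- The (undirected) angle `∠ x v z` at apex `v`. -/
def vangle (x v z : ℂ) : ℝ := |Complex.arg ((x - v) / (z - v))|

/-- A cyclic polygon: a finite set of vertices on the unit circle together with a set of
directed edges such that every vertex has indegree and outdegree one, and any two
consecutive edges `uv`, `vw` have `u, v, w` in anticlockwise order. -/
structure CyclicPolygon where
  V : Finset ℂ
  E : Finset (ℂ × ℂ)
  nonempty : V.Nonempty
  onCircle : ∀ v ∈ V, ‖v‖ = 1
  endmem : ∀ e ∈ E, e.1 ∈ V ∧ e.2 ∈ V
  outdeg : ∀ v ∈ V, ∃! w, (v, w) ∈ E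
  indeg : ∀ v ∈ V, ∃! u, (u, v) ∈ E
  acw : ∀ u v w : ℂ, (u, v) ∈ E → (v, w) ∈ E → ACW u v w

namespace CyclicPolygon

/-- The successor `v⁺` of a vertex. -/
noncomputable def next (P : CyclicPolygon) (v : ℂ) : ℂ :=
  if h : ∃ w, (v, w) ∈ P.E then h.choose else v

/-- The predecessor `v⁻` of a vertex. -/
noncomputable def prev (P : CyclicPolygon) (v : ℂ) : ℂ :=
  if h : ∃ u, (u, v) ∈ P.E then h.choose else v

end CyclicPolygon

/-- The interior angle `∠ v⁻ v v⁺` of `P` at `v`. -/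
def interiorAngle (P : CyclicPolygon) (v : ℂ) : ℝ :=
  vangle (P.prev v) v (P.next v)

/-- The length of an edge `uv`: the number of vertices on the open anticlockwise
arc from `u` to `v`, plus one. -/
def edgeLength (P : CyclicPolygon) (u v : ℂ) : ℕ :=
  ((P.V : Set ℂ) ∩ arcOO u v).ncard + 1

/-- A `k`-star: a cyclic polygon with `2k+1` vertices all of whose edges have length `k`. -/
def IsKStar (S : CyclicPolygon) (k : ℕ) : Prop :=
  S.V.card = 2 * k + 1 ∧ ∀ e ∈ S.E, edgeLength S e.1 e.2 = k

/-- A star: a `k`-star for some positive integer `k`. -/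
def IsStar (S : CyclicPolygon) : Prop := ∃ k : ℕ, 0 < k ∧ IsKStar S k

/-- The segment from `u` to `x` splits the interior angle `∠ u⁻ u u⁺` of `S` at `u`
into the two (smaller, nonzero) angles `∠ u⁻ u x` and `∠ x u u⁺`. -/
def SplitsVertexAngle (S : CyclicPolygon) (u x : ℂ) : Prop :=
  u ∈ S.V ∧ 0 < vangle (S.prev u) u x ∧ 0 < vangle x u (S.next u) ∧
    vangle (S.prev u) u x + vangle x u (S.next u) = vangle (S.prev u) u (S.next u)

/-- `(u, v)` is a linkable pair for the pair of cyclic polygons `(S₁, S₂)`: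
the segment `uv` splits the angle of `S₁` at `u` and the angle of `S₂` at `v`. -/
def LinkablePair (S₁ S₂ : CyclicPolygon) (u v : ℂ) : Prop :=
  u ≠ v ∧ SplitsVertexAngle S₁ u v ∧ SplitsVertexAngle S₂ v u

/-- `u, v` is a linkable pair of vertices of the cyclic polygon `P`. -/
def Linkable (P : CyclicPolygon) (u v : ℂ) : Prop := LinkablePair P P u v

/-- `D` is a set of (undirected) diagonals of `P`, i.e. every member joins a linkable pair. -/
def IsDiagonalSet (P : CyclicPolygon) (D : Set (Sym2 ℂ)) : Prop :=
  ∀ u v : ℂ, s(u, v) ∈ D → Linkable P u v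

/-- The set `D̃` of directed edges associated to a set of diagonals `D`. -/
def tilde (D : Set (Sym2 ℂ)) : Set (ℂ × ℂ) := {e | s(e.1, e.2) ∈ D}

/-- The segment from `v` towards `x` splits the angle `∠ u v w`. -/
def SplitsAngle3 (u v w x : ℂ) : Prop :=
  0 < vangle u v x ∧ 0 < vangle x v w ∧ vangle u v x + vangle x v w = vangle u v w

/-- `𝒮` is a star decomposition of `P` with respect to the diagonal set `D`: the
cycle decomposition of `E ∪ D̃` determined by `f_next` (each cycle follows the
tightest turn, i.e. no diagonal of `D` splits the angle between two consecutive
edges of a cycle), all of whose cycles are stars. -/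
def IsStarDecomp (P : CyclicPolygon) (D : Set (Sym2 ℂ)) (𝒮 : Finset CyclicPolygon) : Prop :=
  IsDiagonalSet P D ∧
  (∀ S ∈ 𝒮, IsStar S ∧ (S.V : Set ℂ) ⊆ (P.V : Set ℂ)) ∧
  (∀ S ∈ 𝒮, (S.E : Set (ℂ × ℂ)) ⊆ (P.E : Set (ℂ × ℂ)) ∪ tilde D) ∧
  (∀ e ∈ (P.E : Set (ℂ × ℂ)) ∪ tilde D, ∃ S ∈ 𝒮, e ∈ S.E) ∧
  (∀ S₁ ∈ 𝒮, ∀ S₂ ∈ 𝒮, S₁ ≠ S₂ → ∀ e : ℂ × ℂ, e ∈ S₁.E → e ∉ S₂.E) ∧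
  (∀ S ∈ 𝒮, ∀ u v w : ℂ, (u, v) ∈ S.E → (v, w) ∈ S.E →
      ¬ ∃ x, s(v, x) ∈ D ∧ SplitsAngle3 u v w x)

/-- `P` admits a star decomposition with respect to `D`. -/
def HasStarDecomp (P : CyclicPolygon) (D : Set (Sym2 ℂ)) : Prop :=
  ∃ 𝒮 : Finset CyclicPolygon, IsStarDecomp P D 𝒮

/-- A maximal star decomposition: no proper superset of `D` admits a star decomposition. -/
def IsMaximalStarDecomp (P : CyclicPolygon) (D : Set (Sym2 ℂ))
    (𝒮 : Finset CyclicPolygon) : Prop :=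
  IsStarDecomp P D 𝒮 ∧ ∀ D' : Set (Sym2 ℂ), D ⊂ D' → ¬ HasStarDecomp P D'

/-- `D'` is obtained from `D` by a diagonal flip: remove one diagonal and add another. -/
def FlipStep (D D' : Set (Sym2 ℂ)) : Prop :=
  ∃ e f : Sym2 ℂ, e ∈ D ∧ f ∉ D ∧ D' = (D \ {e}) ∪ {f}

/-- The two chords `ab` and `cd` are crossing: they share no endpoint and
intersect inside the circle. -/
def Crossing (a b c d : ℂ) : Prop :=
  a ≠ c ∧ a ≠ d ∧ b ≠ c ∧ b ≠ d ∧ (openSegment ℝ a b ∩ openSegment ℝ c d).Nonempty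

/-- The two chords `ab` and `cd` share a common point: they have a common
endvertex or intersect inside the circle. -/
def ShareCommonPoint (a b c d : ℂ) : Prop :=
  a = c ∨ a = d ∨ b = c ∨ b = d ∨ (openSegment ℝ a b ∩ openSegment ℝ c d).Nonempty

/-- Two cyclic polygons have a pair of overlapped angles: a common vertex `y` and a vertex
`x` of either polygon lying on both arcs `⦅y⁺ y⁻⟧` (taken in each polygon). -/
def OverlappedAngles (S₁ S₂ : CyclicPolygon) : Prop :=
  ∃ y : ℂ, y ∈ S₁.V ∧ y ∈ S₂.V ∧
    ∃ x : ℂ, (x ∈ S₁.V ∨ x ∈ S₂.V) ∧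
      x ∈ arcOC (S₁.next y) (S₁.prev y) ∧ x ∈ arcOC (S₂.next y) (S₂.prev y)

/-- Two cyclic polygons are mutually independent: no two of their angles are overlapped. -/
def IndepPolygons (S₁ S₂ : CyclicPolygon) : Prop := ¬ OverlappedAngles S₁ S₂

/-- The edge `uv` of `P` is minimal: no edge `xy` of `P` has all vertices of the closed
arc from `x` to `y` inside the open arc from `u` to `v`. -/
def MinimalEdge (P : CyclicPolygon) (u v : ℂ) : Prop :=
  (u, v) ∈ P.E ∧
    ¬ ∃ x y : ℂ, (x, y) ∈ P.E ∧ ∀ z ∈ P.V, z ∈ arcCC x y → z ∈ arcOO u v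

/-- `vs` enumerates the star `S` as `v₀ v₁ ⋯ v₂ₖ` with `v₁ = v`, `v₀ = v⁻` (so that `v⁻v`
is an edge of `S`), each edge of `S` is an edge of `P` or a diagonal of `P`, and all the
edges `v₂ᵢ₋₁v₂ᵢ` are edges of `P`. -/
def IsBorderCandidate (P : CyclicPolygon) (v : ℂ) (S : CyclicPolygon) (k : ℕ)
    (vs : ℕ → ℂ) : Prop :=
  0 < k ∧ IsStar S ∧ S.V.card = 2 * k + 1 ∧
  (S.V : Set ℂ) ⊆ (P.V : Set ℂ) ∧
  vs 0 = P.prev v ∧ vs 1 = v ∧ vs (2 * k + 1) = vs 0 ∧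
  (∀ x ∈ S.V, ∃ i ≤ 2 * k, vs i = x) ∧
  (∀ i ≤ 2 * k, (vs i, vs (i + 1)) ∈ S.E) ∧
  (∀ i ≤ 2 * k, (vs i, vs (i + 1)) ∈ P.E ∨ Linkable P (vs i) (vs (i + 1))) ∧
  (∀ i : ℕ, 1 ≤ i → i ≤ k → (vs (2 * i - 1), vs (2 * i)) ∈ P.E)

/-- The angle sequence `(∠v₁v₂v₃, ∠v₃v₄v₅, …, ∠v₂ₖ₋₁v₂ₖv₀)` of an enumerated star. -/
noncomputable def angleList (vs : ℕ → ℂ) (k : ℕ) : List ℝ :=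
  (List.range k).map fun i => vangle (vs (2 * i + 1)) (vs (2 * i + 2)) (vs (2 * i + 3))

/-- `S` is the border star `S*(P, v)`: among all border candidates, its angle sequence is
lexicographically minimal. -/
def IsBorderStar (P : CyclicPolygon) (v : ℂ) (S : CyclicPolygon) : Prop :=
  ∃ (k : ℕ) (vs : ℕ → ℂ), IsBorderCandidate P v S k vs ∧
    ∀ (S' : CyclicPolygon) (k' : ℕ) (vs' : ℕ → ℂ), IsBorderCandidate P v S' k' vs' →
      ¬ List.Lex (· < ·) (angleList vs' k') (angleList vs k)


namespace SD

variable {n : ℕ} [NeZero n]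

/-- Value of a difference in `ZMod n`. -/
lemma vsub (y x : ZMod n) :
    (y - x).val = if x.val ≤ y.val then y.val - x.val else y.val + n - x.val := by
  have hx := ZMod.val_lt x
  have hy := ZMod.val_lt y
  split_ifs with h
  · exact ZMod.val_sub h
  · have h1 : y - x = ((y.val + n - x.val : ℕ) : ZMod n) := by
      rw [Nat.cast_sub (by omega)]
      simp
    rw [h1, ZMod.val_natCast, Nat.mod_eq_of_lt (by omega)]

lemma vsucc (t : ZMod n) :
    (t + 1).val = if t.val + 1 = n then 0 else t.val + 1 := by
  have ht := ZMod.val_lt t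
  have h1 : t + 1 = ((t.val + 1 : ℕ) : ZMod n) := by simp
  rw [h1, ZMod.val_natCast]
  split_ifs with h
  · rw [h, Nat.mod_self]
  · rw [Nat.mod_eq_of_lt (by omega)]

lemma vneg (x y : ZMod n) (h : x ≠ y) : (x - y).val + (y - x).val = n := by
  have hx := ZMod.val_lt x
  have hy := ZMod.val_lt y
  have : x.val ≠ y.val := fun h' => h (ZMod.val_injective n h')
  rw [vsub, vsub]
  split_ifs <;> omega

lemma vpos (x y : ZMod n) : 0 < (x - y).val ↔ x ≠ y := by
  rw [Nat.pos_iff_ne_zero, Ne, ZMod.val_eq_zero, sub_eq_zero]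

/-- Admissible permutations: the combinatorial data of a cyclic polygon. -/
structure Adm (nx : Equiv.Perm (ZMod n)) : Prop where
  pos : ∀ x, 0 < (nx x - x).val
  lt : ∀ x, (nx x - x).val < (nx.symm x - x).val

/-- `x` is active in the phase interval `(t, t+1)`. -/
def act (nx : Equiv.Perm (ZMod n)) (t x : ZMod n) : Prop :=
  (nx x - x).val ≤ (t - x - x).val ∧ (t - x - x).val < (nx.symm x - x).val

def link1 (nx : Equiv.Perm (ZMod n)) (x y : ZMod n) : Prop :=
  (nx x - x).val < (y - x).val ∧ (y - x).val < (nx.symm x - x).val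

def link (nx : Equiv.Perm (ZMod n)) (x y : ZMod n) : Prop :=
  link1 nx x y ∧ link1 nx y x

lemma link.symm {nx : Equiv.Perm (ZMod n)} {x y : ZMod n} (h : link nx x y) : link nx y x :=
  ⟨h.2, h.1⟩

lemma link.ne {nx : Equiv.Perm (ZMod n)} {x y : ZMod n} (h : link nx x y) : x ≠ y := by
  have h1 := h.1.1
  have : 0 < (y - x).val := by omega
  exact ((vpos _ _).1 this).symm

/-- `x` jumps at phase `t`. -/
def jmp (nx : Equiv.Perm (ZMod n)) (D : Set (Sym2 (ZMod n))) (t x : ZMod n) : Prop :=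
  s(x, t - x) ∈ D ∨ nx x = t - x ∨ nx (t - x) = x

lemma jmp_inv (nx : Equiv.Perm (ZMod n)) (D : Set (Sym2 (ZMod n))) (t x : ZMod n) :
    jmp nx D t (t - x) ↔ jmp nx D t x := by
  unfold jmp
  rw [sub_sub_cancel, Sym2.eq_swap]
  tauto

def stpf (nx : Equiv.Perm (ZMod n)) (D : Set (Sym2 (ZMod n))) (t x : ZMod n) : ZMod n :=
  if jmp nx D t x then t - x else x

lemma stpf_inv (nx : Equiv.Perm (ZMod n)) (D : Set (Sym2 (ZMod n))) (t : ZMod n) :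
    Function.Involutive (stpf nx D t) := by
  intro x
  unfold stpf
  by_cases h : jmp nx D t x
  · rw [if_pos h, if_pos ((jmp_inv nx D t x).2 h), sub_sub_cancel]
  · rw [if_neg h, if_neg h]

def stp (nx : Equiv.Perm (ZMod n)) (D : Set (Sym2 (ZMod n))) (t : ZMod n) :
    Equiv.Perm (ZMod n) := (stpf_inv nx D t).toPerm

lemma stp_apply (nx : Equiv.Perm (ZMod n)) (D : Set (Sym2 (ZMod n))) (t x : ZMod n) :
    stp nx D t x = if jmp nx D t x then t - x else x := rfl

lemma stp_of_jmp {nx : Equiv.Perm (ZMod n)} {D : Set (Sym2 (ZMod n))} {t x : ZMod n}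
    (h : jmp nx D t x) : stp nx D t x = t - x := by rw [stp_apply, if_pos h]

lemma stp_of_not {nx : Equiv.Perm (ZMod n)} {D : Set (Sym2 (ZMod n))} {t x : ZMod n}
    (h : ¬ jmp nx D t x) : stp nx D t x = x := by rw [stp_apply, if_neg h]

/-- Trajectories. -/
def T (nx : Equiv.Perm (ZMod n)) (D : Set (Sym2 (ZMod n))) : ℕ → Equiv.Perm (ZMod n)
  | 0 => 1
  | k + 1 => stp nx D ((k + 1 : ℕ) : ZMod n) * T nx D k

lemma T_succ (nx : Equiv.Perm (ZMod n)) (D : Set (Sym2 (ZMod n))) (k : ℕ) (x : ZMod n) :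
    T nx D (k + 1) x = stp nx D ((k + 1 : ℕ) : ZMod n) (T nx D k x) := rfl

def IsDiag (nx : Equiv.Perm (ZMod n)) (D : Set (Sym2 (ZMod n))) : Prop :=
  ∀ x y, s(x, y) ∈ D → link nx x y

def Good (nx : Equiv.Perm (ZMod n)) (D : Set (Sym2 (ZMod n))) : Prop :=
  IsDiag nx D ∧ ∀ x, act nx 0 x → T nx D n x = x

/-- an active vertex sees its moving end strictly after `nx x`. -/
lemma act_move {nx : Equiv.Perm (ZMod n)} (_ : Adm nx) {t x : ZMod n} (h : act nx t x) :
    (t + 1 - x - x).val = (t - x - x).val + 1 := by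
  have h2 := h.2
  have h3 := ZMod.val_lt (nx.symm x - x)
  have : t + 1 - x - x = (t - x - x) + 1 := by ring
  rw [this, vsucc, if_neg (by omega)]

lemma act_step {nx : Equiv.Perm (ZMod n)} (hn : Adm nx) {D : Set (Sym2 (ZMod n))}
    (hD : IsDiag nx D) (t x : ZMod n) :
    act nx (t + 1) (stp nx D (t + 1) x) ↔ act nx t x := by
  have hlt := hn.lt x
  have hpos := hn.pos x
  have hb := ZMod.val_lt (nx.symm x - x)
  have hd := ZMod.val_lt (t - x - x)
  have hde : (t + 1 - x - x).val = if (t - x - x).val + 1 = n then 0 else (t - x - x).val + 1 := by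
    rw [← vsucc]; congr 1; ring
  by_cases h : jmp nx D (t + 1) x
  · rw [stp_of_jmp h]
    generalize hy : t + 1 - x = y at *
    have e1 : t + 1 - y - y = x - y := by rw [← hy]; ring
    unfold act
    rw [e1]
    rcases h with h | h | h
    · rw [hy] at h
      have hl := hD _ _ h
      have a1 := hl.1.1
      have a2 := hl.1.2
      have a3 := hl.2.1
      have a4 := hl.2.2
      split_ifs at hde
      · omega
      · constructor
        · intro; omega
        · intro; omega
    · rw [hy] at h
      have h' : nx.symm y = x := by rw [← h]; simp
      rw [h', h]
      split_ifs at hde <;> omega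
    · rw [hy] at h
      have h' : nx.symm x = y := by rw [← h]; simp
      have := hn.lt y
      rw [h] at this ⊢
      rw [h'] at hlt ⊢
      split_ifs at hde <;> omega
  · rw [stp_of_not h]
    unfold jmp at h
    push Not at h
    obtain ⟨-, h1, h2⟩ := h
    have h1' : (nx x - x).val ≠ (t + 1 - x - x).val := by
      intro h'
      exact h1 (sub_left_injective (ZMod.val_injective n h'))
    have h2' : (nx.symm x - x).val ≠ (t + 1 - x - x).val := by
      intro h'
      have := (sub_left_injective (ZMod.val_injective n h'))
      apply h2
      rw [← this]; simp
    unfold act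
    split_ifs at hde <;> omega

lemma act_T {nx : Equiv.Perm (ZMod n)} (hn : Adm nx) {D : Set (Sym2 (ZMod n))}
    (hD : IsDiag nx D) (k : ℕ) (x : ZMod n) :
    act nx (k : ZMod n) (T nx D k x) ↔ act nx 0 x := by
  induction k with
  | zero => simp [T]
  | succ k ih =>
    rw [T_succ, ← ih]
    push_cast
    exact act_step hn hD _ _

end SD

namespace SD

variable {n : ℕ} [NeZero n]

/-- parity function deciding which of two parallel lines is on top -/
def gp (n : ℕ) (t X Y : ℤ) : ℤ := (X + Y - t - 1) / (n : ℤ) + (X - Y) / (n : ℤ)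

lemma npos' : (0 : ℤ) < (n : ℤ) := by
  have := NeZero.pos n
  exact_mod_cast this

lemma div_neg1 (u v : ℤ) (h : v = -u - 1) : v / (n : ℤ) = - (u / (n : ℤ)) - 1 := by
  subst h
  have hn := npos' (n := n)
  have h1 := Int.emod_add_mul_ediv u n
  have h2 := Int.emod_nonneg u hn.ne'
  have h3 := Int.emod_lt_of_pos u hn
  rw [Int.ediv_eq_iff_of_pos hn]
  constructor <;> nlinarith

lemma div_pred (u v : ℤ) (h : v = u - 1) (hu : ¬ (n : ℤ) ∣ u) : v / (n : ℤ) = u / (n : ℤ) := by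
  subst h
  have hn := npos' (n := n)
  have h1 := Int.emod_add_mul_ediv u n
  have h2 := Int.emod_nonneg u hn.ne'
  have h3 := Int.emod_lt_of_pos u hn
  have h4 : u % n ≠ 0 := fun h => hu (Int.dvd_of_emod_eq_zero h)
  have h5 : 0 < u % n := by omega
  rw [Int.ediv_eq_iff_of_pos hn]
  constructor <;> nlinarith

lemma div_pred' (u v : ℤ) (h : v = u - 1) (hu : (n : ℤ) ∣ u) :
    v / (n : ℤ) = u / (n : ℤ) - 1 := by
  subst h
  have hn := npos' (n := n)
  obtain ⟨k, rfl⟩ := hu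
  rw [Int.mul_ediv_cancel_left _ hn.ne', Int.ediv_eq_iff_of_pos hn]
  constructor <;> nlinarith

lemma gp_lift (t X Y X' Y' : ℤ) (hX : (n : ℤ) ∣ X' - X) (hY : (n : ℤ) ∣ Y' - Y) :
    (gp n t X' Y' - gp n t X Y) % 2 = 0 := by
  have hn := npos' (n := n)
  obtain ⟨a, ha⟩ := hX
  obtain ⟨b, hb⟩ := hY
  have e1 : X' + Y' - t - 1 = (X + Y - t - 1) + (n : ℤ) * (a + b) := by linear_combination ha + hb
  have e2 : X' - Y' = (X - Y) + (n : ℤ) * (a - b) := by linear_combination ha - hb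
  unfold gp
  rw [e1, e2, Int.add_mul_ediv_left _ _ hn.ne', Int.add_mul_ediv_left _ _ hn.ne']
  omega

lemma gp_turn (t X Y : ℤ) : gp n (t + n) X Y = gp n t X Y - 1 := by
  have hn := npos' (n := n)
  unfold gp
  have e1 : X + Y - (t + n) - 1 = (X + Y - t - 1) + (n : ℤ) * (-1) := by ring
  rw [e1, Int.add_mul_ediv_left _ _ hn.ne']
  ring

lemma gp_stay (t X Y : ℤ) (h : ¬ (n : ℤ) ∣ X + Y - (t + 1)) :
    gp n (t + 1) X Y = gp n t X Y := by
  unfold gp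
  rw [div_pred (X + Y - (t + 1)) _ (by ring) h]
  congr 2; ring

lemma gp_jump1 (t X Y : ℤ) (h : ¬ (n : ℤ) ∣ X + Y - (t + 1)) :
    (gp n (t + 1) (t + 1 - X) Y - gp n t X Y) % 2 = 0 := by
  have h1 : (X + Y - t - 1) / (n : ℤ) = (X + Y - (t + 1)) / (n : ℤ) := by congr 1; ring
  have h2 := div_neg1 (n := n) (X - Y) (t + 1 - X + Y - (t + 1) - 1) (by ring)
  have h3 := div_neg1 (n := n) (X + Y - (t + 1) - 1) (t + 1 - X - Y) (by ring)
  rw [div_pred (X + Y - (t + 1)) _ rfl h] at h3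
  unfold gp
  rw [h1, h2, h3]
  omega

lemma gp_swap (t X Y : ℤ) (h : ¬ (n : ℤ) ∣ X - Y) :
    gp n t Y X = gp n t X Y - 2 * ((X - Y) / (n : ℤ)) - 1 := by
  have h3 := div_neg1 (n := n) (X - Y - 1) (Y - X) (by ring)
  rw [div_pred (X - Y) _ rfl h] at h3
  unfold gp
  rw [h3, add_comm Y X]
  ring

lemma gp_jump2 (t X Y : ℤ) (h : ¬ (n : ℤ) ∣ X + Y - (t + 1)) (hXY : ¬ (n : ℤ) ∣ X - Y) :
    (gp n (t + 1) X (t + 1 - Y) - gp n t X Y) % 2 = 0 := by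
  have hYX : ¬ (n : ℤ) ∣ Y - X := by rwa [dvd_sub_comm]
  have h1 := gp_jump1 t Y X (by rwa [add_comm Y X])
  have h2 := gp_swap t X Y hXY
  have h3 := gp_swap (t + 1) (t + 1 - Y) X (by
    intro h2; apply h; rw [show X + Y - (t + 1) = -(t + 1 - Y - X) by ring]; exact dvd_neg.2 h2)
  omega

lemma gp_jump12 (t X Y : ℤ) (hXY : ¬ (n : ℤ) ∣ X - Y) :
    (gp n (t + 1) (t + 1 - X) (t + 1 - Y) - gp n t X Y) % 2 = 0 := by
  have h1 : (X + Y - t - 1) / (n : ℤ) = (X + Y - (t + 1)) / (n : ℤ) := by congr 1; ring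
  have h2 := div_neg1 (n := n) (X + Y - (t + 1)) (t + 1 - X + (t + 1 - Y) - (t + 1) - 1) (by ring)
  have h3 := div_neg1 (n := n) (X - Y - 1) (t + 1 - X - (t + 1 - Y)) (by ring)
  rw [div_pred (X - Y) _ rfl hXY] at h3
  unfold gp
  rw [h1, h2, h3]
  omega

lemma cast_dvd (X Y : ℤ) : (n : ℤ) ∣ X - Y ↔ (Y : ZMod n) = (X : ZMod n) := by
  rw [ZMod.intCast_eq_intCast_iff_dvd_sub]

/-- The crossing lemma: two distinct closed curves cross. -/
lemma crossing {nx : Equiv.Perm (ZMod n)} (hn : Adm nx) {D : Set (Sym2 (ZMod n))}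
    (hD : Good nx D) {x y : ZMod n} (hx : act nx 0 x) (hy : act nx 0 y) (hxy : x ≠ y) :
    ∃ k < n, link nx (T nx D k x) (T nx D k y) ∧
      T nx D k x + T nx D k y = ((k + 1 : ℕ) : ZMod n) ∧
      s(T nx D k x, T nx D k y) ∉ D := by
  by_contra hcon
  push Not at hcon
  have key : ∀ k ≤ n, (gp n k (T nx D k x).val (T nx D k y).val
      - gp n 0 x.val y.val) % 2 = 0 := by
    intro k
    induction k with
    | zero => intro _; simp [T]
    | succ k ih =>
      intro hk
      have ih := ih (by omega)
      have hc := hcon k (by omega)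
      have hax := (act_T hn hD.1 k x).2 hx
      have hay := (act_T hn hD.1 k y).2 hy
      have hne : T nx D k x ≠ T nx D k y := fun h => hxy ((T nx D k).injective h)
      rw [T_succ, T_succ]
      generalize T nx D k x = a at *
      generalize T nx D k y = b at *
      have hdv : ¬ (n : ℤ) ∣ (a.val : ℤ) - b.val := by
        rw [cast_dvd]; simpa using hne.symm
      set t : ℤ := (k : ℤ) with ht
      have htc : ((k + 1 : ℕ) : ZMod n) = ((t + 1 : ℤ) : ZMod n) := by simp [ht]
      have htc' : ((k + 1 : ℕ) : ℤ) = t + 1 := by simp [ht]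
      rw [htc']
      -- reduce to lifts
      suffices h : ∃ A B : ℤ, (A : ZMod n) = stp nx D ((k + 1 : ℕ) : ZMod n) a ∧
          (B : ZMod n) = stp nx D ((k + 1 : ℕ) : ZMod n) b ∧
          (gp n (t + 1) A B - gp n t a.val b.val) % 2 = 0 by
        obtain ⟨A, B, hA, hB, hAB⟩ := h
        have := gp_lift (n := n) (t + 1) A B (stp nx D ((k + 1 : ℕ) : ZMod n) a).val
          (stp nx D ((k + 1 : ℕ) : ZMod n) b).val
          (by rw [cast_dvd]; simpa using hA) (by rw [cast_dvd]; simpa using hB)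
        omega
      have hca : ((t + 1 - a.val : ℤ) : ZMod n) = ((k + 1 : ℕ) : ZMod n) - a := by
        rw [htc]; push_cast; simp
      have hcb : ((t + 1 - b.val : ℤ) : ZMod n) = ((k + 1 : ℕ) : ZMod n) - b := by
        rw [htc]; push_cast; simp
      by_cases hm : a + b = ((k + 1 : ℕ) : ZMod n)
      · -- meeting
        have hb' : ((k + 1 : ℕ) : ZMod n) - a = b := by rw [← hm]; ring
        have ha' : ((k + 1 : ℕ) : ZMod n) - b = a := by rw [← hm]; ring
        have hka : ((k : ZMod n) + 1) = ((k + 1 : ℕ) : ZMod n) := by push_cast; ring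
        have m1 := act_move hn hax
        have m2 := act_move hn hay
        rw [hka, hb'] at m1
        rw [hka, ha'] at m2
        have n1 : (b - a).val ≠ (nx.symm a - a).val := by
          intro h
          have h1 := sub_left_injective (ZMod.val_injective n h)
          have h2 : nx b = a := by rw [h1]; simp
          have := hay.1
          rw [h2] at this; omega
        have n2 : (a - b).val ≠ (nx.symm b - b).val := by
          intro h
          have h1 := sub_left_injective (ZMod.val_injective n h)
          have h2 : nx a = b := by rw [h1]; simp
          have := hax.1
          rw [h2] at this; omega
        have hl : link nx a b := by
          have := hax.1; have := hax.2; have := hay.1; have := hay.2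
          refine ⟨⟨?_, ?_⟩, ⟨?_, ?_⟩⟩ <;> omega
        have hmem := hc hl hm
        refine ⟨t + 1 - a.val, t + 1 - b.val, ?_, ?_, gp_jump12 t _ _ hdv⟩
        · rw [hca, stp_of_jmp]; left; rw [hb']; exact hmem
        · rw [hcb, stp_of_jmp]; left; rw [ha', Sym2.eq_swap]; exact hmem
      · have hm' : ¬ (n : ℤ) ∣ (a.val : ℤ) + b.val - (t + 1) := by
          rw [cast_dvd, ← htc]; intro h; apply hm; rw [h]; push_cast; simp
        by_cases ja : jmp nx D ((k + 1 : ℕ) : ZMod n) a <;>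
        by_cases jb : jmp nx D ((k + 1 : ℕ) : ZMod n) b
        · exact ⟨_, _, by rw [hca, stp_of_jmp ja], by rw [hcb, stp_of_jmp jb], gp_jump12 t _ _ hdv⟩
        · exact ⟨_, b.val, by rw [hca, stp_of_jmp ja], by rw [stp_of_not jb]; simp,
            gp_jump1 t _ _ hm'⟩
        · exact ⟨a.val, _, by rw [stp_of_not ja]; simp, by rw [hcb, stp_of_jmp jb],
            gp_jump2 t _ _ hm' hdv⟩
        · exact ⟨a.val, b.val, by rw [stp_of_not ja]; simp, by rw [stp_of_not jb]; simp,
            by rw [gp_stay t _ _ hm']; simp⟩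
  have h := key n le_rfl
  rw [hD.2 x hx, hD.2 y hy] at h
  have h2 := gp_turn (n := n) 0 x.val y.val
  rw [zero_add] at h2
  omega

end SD

namespace SD

variable {n : ℕ} [NeZero n]

/-- toggling a diagonal -/
def tog (D : Set (Sym2 (ZMod n))) (f : Sym2 (ZMod n)) : Set (Sym2 (ZMod n)) :=
  {g | (g ∈ D ∧ g ≠ f) ∨ (g ∉ D ∧ g = f)}

lemma link_nx {nx : Equiv.Perm (ZMod n)} {x y : ZMod n} (h : link nx x y) :
    nx x ≠ y ∧ nx y ≠ x := by
  constructor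
  · rintro rfl
    exact lt_irrefl _ h.1.1
  · rintro rfl
    exact lt_irrefl _ h.2.1

lemma stp_tog_ne {nx : Equiv.Perm (ZMod n)} {D : Set (Sym2 (ZMod n))} {x y t : ZMod n}
    (ht : t ≠ x + y) : stp nx (tog D s(x, y)) t = stp nx D t := by
  ext z
  have : jmp nx (tog D s(x, y)) t z ↔ jmp nx D t z := by
    unfold jmp
    have : s(z, t - z) ∈ tog D s(x, y) ↔ s(z, t - z) ∈ D := by
      have hne : s(z, t - z) ≠ s(x, y) := by
        intro h
        apply ht
        rw [Sym2.eq_iff] at h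
        rcases h with ⟨h1, h2⟩ | ⟨h1, h2⟩
        · rw [← h1, ← h2]; ring
        · rw [← h1, ← h2]; ring
      simp [tog, hne]
    rw [this]
  rw [stp_apply, stp_apply]
  simp only [this]

lemma stp_tog_eq {nx : Equiv.Perm (ZMod n)} {D : Set (Sym2 (ZMod n))} {x y : ZMod n}
    (h : link nx x y) : stp nx (tog D s(x, y)) (x + y) = stp nx D (x + y) * Equiv.swap x y := by
  ext1 z
  have hxy := h.ne
  obtain ⟨l1, l2⟩ := link_nx h
  have e1 : x + y - x = y := by ring
  have e2 : x + y - y = x := by ring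
  rw [Equiv.Perm.mul_apply]
  have hm : s(x, y) ∈ tog D s(x, y) ↔ s(x, y) ∉ D := by simp [tog]
  have hj1 : jmp nx (tog D s(x, y)) (x + y) x ↔ s(x, y) ∉ D := by
    unfold jmp; rw [e1, hm]; tauto
  have hj2 : jmp nx (tog D s(x, y)) (x + y) y ↔ s(x, y) ∉ D := by
    unfold jmp; rw [e2, Sym2.eq_swap (a := y) (b := x), hm]; tauto
  have hk1 : jmp nx D (x + y) x ↔ s(x, y) ∈ D := by
    unfold jmp; rw [e1]; tauto
  have hk2 : jmp nx D (x + y) y ↔ s(x, y) ∈ D := by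
    unfold jmp; rw [e2, Sym2.eq_swap]; tauto
  by_cases hzx : z = x
  · subst hzx
    rw [Equiv.swap_apply_left, stp_apply, stp_apply]
    simp only [hj1, hk2, e1, e2]
    by_cases s(z, y) ∈ D <;> simp [*]
  by_cases hzy : z = y
  · subst hzy
    rw [Equiv.swap_apply_right, stp_apply, stp_apply]
    simp only [hj2, hk1, e1, e2]
    by_cases s(x, z) ∈ D <;> simp [*]
  rw [Equiv.swap_apply_of_ne_of_ne hzx hzy, stp_apply, stp_apply]
  have : jmp nx (tog D s(x, y)) (x + y) z ↔ jmp nx D (x + y) z := by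
    unfold jmp
    have hne : s(z, x + y - z) ≠ s(x, y) := by
      intro h
      rw [Sym2.eq_iff] at h
      tauto
    have : s(z, x + y - z) ∈ tog D s(x, y) ↔ s(z, x + y - z) ∈ D := by
      simp [tog, hne]
    rw [this]
  simp only [this]

/-- index (phase minus one) of a pair -/
def idx (f : Sym2 (ZMod n)) : ℕ :=
  Sym2.lift ⟨fun x y => (x + y - 1).val, fun x y => by simp only [add_comm x y]⟩ f

lemma idx_mk (x y : ZMod n) : idx s(x, y) = (x + y - 1).val := rfl

lemma idx_lt (f : Sym2 (ZMod n)) : idx f < n := by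
  induction f using Sym2.ind with
  | _ x y => exact ZMod.val_lt _

lemma idx_spec (x y : ZMod n) : ((idx s(x, y) + 1 : ℕ) : ZMod n) = x + y := by
  rw [idx_mk]; push_cast; simp

lemma idx_uniq (x y : ZMod n) (k : ℕ) (hk : k < n) (h : ((k + 1 : ℕ) : ZMod n) = x + y) :
    idx s(x, y) = k := by
  rw [idx_mk, ← h]; push_cast; simp [Nat.mod_eq_of_lt hk]

def lbl (nx : Equiv.Perm (ZMod n)) (D : Set (Sym2 (ZMod n))) (f : Sym2 (ZMod n)) :
    Sym2 (ZMod n) := Sym2.map (T nx D (idx f)).symm f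

lemma T_tog_le {nx : Equiv.Perm (ZMod n)} {D : Set (Sym2 (ZMod n))} {x y : ZMod n} (m : ℕ)
    (hm : m ≤ idx s(x, y)) : T nx (tog D s(x, y)) m = T nx D m := by
  induction m with
  | zero => rfl
  | succ m ih =>
    have ih := ih (by omega)
    show stp _ _ _ * _ = stp _ _ _ * _
    rw [ih, stp_tog_ne]
    intro h
    have := idx_lt s(x, y)
    have := idx_uniq x y m (by omega) h
    omega

lemma T_tog_gt {nx : Equiv.Perm (ZMod n)} {D : Set (Sym2 (ZMod n))} {x y : ZMod n}
    (h : link nx x y) (m : ℕ) (hm : idx s(x, y) < m) (hmn : m ≤ n) :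
    T nx (tog D s(x, y)) m = T nx D m *
      Equiv.swap ((T nx D (idx s(x, y))).symm x) ((T nx D (idx s(x, y))).symm y) := by
  induction m with
  | zero => omega
  | succ m ih =>
    show stp _ _ _ * _ = (stp _ _ _ * _) * _
    by_cases hk : idx s(x, y) = m
    · rw [← hk, T_tog_le _ le_rfl, idx_spec, stp_tog_eq h, mul_assoc, mul_assoc,
        Equiv.swap_mul_eq_mul_swap]
      rfl
    · rw [ih (by omega) (by omega), mul_assoc, stp_tog_ne]
      intro h
      exact hk (idx_uniq x y m (by omega) h)

lemma act_link {nx : Equiv.Perm (ZMod n)} (hn : Adm nx) {x y : ZMod n}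
    (h : link1 nx x y) : act nx (idx s(x, y) : ZMod n) x := by
  have h1 : ((idx s(x, y) : ZMod n)) = x + y - 1 := by
    have := idx_spec x y; push_cast at this; rw [← this]; ring
  rw [h1]
  have := vsucc (x + y - 1 - x - x)
  rw [show x + y - 1 - x - x + 1 = y - x by ring] at this
  have := h.1
  have := h.2
  have := hn.pos x
  have := ZMod.val_lt (nx.symm x - x)
  unfold act
  split_ifs at * <;> omega

lemma act_lbl {nx : Equiv.Perm (ZMod n)} (hn : Adm nx) {D : Set (Sym2 (ZMod n))}
    (hD : IsDiag nx D) {x y : ZMod n} (h : link nx x y) :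
    act nx 0 ((T nx D (idx s(x, y))).symm x) ∧ act nx 0 ((T nx D (idx s(x, y))).symm y) := by
  rw [← act_T hn hD (idx s(x, y)), ← act_T hn hD (idx s(x, y))]
  simp only [Equiv.apply_symm_apply]
  exact ⟨act_link hn h.1, by rw [Sym2.eq_swap]; exact act_link hn h.2⟩

lemma lbl_tog {nx : Equiv.Perm (ZMod n)} {D : Set (Sym2 (ZMod n))} {x y : ZMod n}
    (h : link nx x y) (g : Sym2 (ZMod n)) :
    lbl nx (tog D s(x, y)) g = lbl nx D g ∨
    lbl nx (tog D s(x, y)) g = Sym2.map (Equiv.swap ((T nx D (idx s(x, y))).symm x)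
      ((T nx D (idx s(x, y))).symm y)) (lbl nx D g) := by
  by_cases hk : idx g ≤ idx s(x, y)
  · left
    unfold lbl
    rw [T_tog_le _ hk]
  · right
    unfold lbl
    rw [T_tog_gt h _ (by omega) (idx_lt g).le, Sym2.map_map]
    congr 1

lemma map_swap_eq (a b : ZMod n) (p : Sym2 (ZMod n)) :
    Sym2.map (Equiv.swap a b) p = s(a, b) ↔ p = s(a, b) := by
  have h : Sym2.map (Equiv.swap a b) s(a, b) = s(a, b) := by
    simp [Sym2.eq_swap]
  constructor
  · intro h'
    apply Sym2.map.injective (Equiv.swap a b).injective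
    rw [h, h']
  · rintro rfl; exact h

lemma lbl_tog_iff {nx : Equiv.Perm (ZMod n)} {D : Set (Sym2 (ZMod n))} {x y : ZMod n}
    (h : link nx x y) (g : Sym2 (ZMod n)) :
    lbl nx (tog D s(x, y)) g = lbl nx D s(x, y) ↔ lbl nx D g = lbl nx D s(x, y) := by
  have e : lbl nx D s(x, y) = s((T nx D (idx s(x, y))).symm x, (T nx D (idx s(x, y))).symm y) := rfl
  rcases lbl_tog (D := D) h g with h' | h'
  · rw [h']
  · rw [h', e, map_swap_eq]

lemma T_tog_n {nx : Equiv.Perm (ZMod n)} {D : Set (Sym2 (ZMod n))} {x y : ZMod n}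
    (h : link nx x y) (a b : ZMod n) (hab : lbl nx D s(x, y) = s(a, b)) :
    T nx (tog D s(x, y)) n = T nx D n * Equiv.swap a b := by
  rw [T_tog_gt h n (idx_lt _) le_rfl]
  have e : lbl nx D s(x, y) = s((T nx D (idx s(x, y))).symm x, (T nx D (idx s(x, y))).symm y) := rfl
  rw [e, Sym2.eq_iff] at hab
  rcases hab with ⟨h1, h2⟩ | ⟨h1, h2⟩
  · rw [h1, h2]
  · rw [h1, h2, Equiv.swap_comm]

lemma IsDiag_tog {nx : Equiv.Perm (ZMod n)} {D : Set (Sym2 (ZMod n))} (hD : IsDiag nx D)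
    {x y : ZMod n} (h : link nx x y) : IsDiag nx (tog D s(x, y)) := by
  intro u v huv
  rcases huv with ⟨h1, _⟩ | ⟨_, h2⟩
  · exact hD _ _ h1
  · rw [Sym2.eq_iff] at h2
    rcases h2 with ⟨rfl, rfl⟩ | ⟨rfl, rfl⟩
    · exact h
    · exact h.symm

/-- Toggling two pairs preserves goodness iff their labels agree. -/
lemma good_tog2 {nx : Equiv.Perm (ZMod n)} (hn : Adm nx) {D : Set (Sym2 (ZMod n))}
    (hD : Good nx D) {x y z w : ZMod n} (h : link nx x y) (h' : link nx z w) :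
    Good nx (tog (tog D s(x, y)) s(z, w)) ↔ lbl nx D s(z, w) = lbl nx D s(x, y) := by
  have hd1 := IsDiag_tog hD.1 h
  have hd2 := IsDiag_tog hd1 h'
  rw [← lbl_tog_iff h]
  obtain ⟨ha, hb⟩ := act_lbl hn hD.1 h
  obtain ⟨ha', hb'⟩ := act_lbl hn hd1 h'
  have hne' : (T nx (tog D s(x, y)) (idx s(z, w))).symm z ≠
    (T nx (tog D s(x, y)) (idx s(z, w))).symm w := fun e => h'.ne ((Equiv.injective _) e)
  have e1 : lbl nx D s(x, y) = s((T nx D (idx s(x, y))).symm x, (T nx D (idx s(x, y))).symm y) := rfl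
  have e2 : lbl nx (tog D s(x, y)) s(z, w) = s((T nx (tog D s(x, y)) (idx s(z, w))).symm z,
    (T nx (tog D s(x, y)) (idx s(z, w))).symm w) := rfl
  rw [e1, e2]
  have t2 := T_tog_n h' _ _ e2
  rw [T_tog_n h _ _ e1] at t2
  generalize (T nx D (idx s(x, y))).symm x = a at *
  generalize (T nx D (idx s(x, y))).symm y = b at *
  generalize (T nx (tog D s(x, y)) (idx s(z, w))).symm z = a' at *
  generalize (T nx (tog D s(x, y)) (idx s(z, w))).symm w = b' at *
  constructor
  · intro hG
    have h1 := hG.2 a' ha'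
    rw [t2, Equiv.Perm.mul_apply, Equiv.Perm.mul_apply, Equiv.swap_apply_left] at h1
    have hact : act nx 0 (Equiv.swap a b b') := by
      by_cases h1 : b' = a
      · rw [h1, Equiv.swap_apply_left]; exact hb
      by_cases h2 : b' = b
      · rw [h2, Equiv.swap_apply_right]; exact ha
      rw [Equiv.swap_apply_of_ne_of_ne h1 h2]; exact hb'
    rw [hD.2 _ hact] at h1
    by_cases h1' : b' = a
    · rw [h1', Equiv.swap_apply_left] at h1
      rw [h1', h1, Sym2.eq_swap]
    by_cases h2' : b' = b
    · rw [h2', Equiv.swap_apply_right] at h1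
      rw [h2', h1]
    rw [Equiv.swap_apply_of_ne_of_ne h1' h2'] at h1
    exact absurd h1.symm hne'
  · intro hl
    refine ⟨hd2, fun u hu => ?_⟩
    have : Equiv.swap a' b' = Equiv.swap a b := by
      rw [Sym2.eq_iff] at hl
      rcases hl with ⟨rfl, rfl⟩ | ⟨rfl, rfl⟩
      · rfl
      · exact Equiv.swap_comm _ _
    rw [t2, this, mul_assoc, Equiv.swap_mul_self, mul_one]
    exact hD.2 u hu

/-- The finite set of linkable pairs. -/
def Lset (nx : Equiv.Perm (ZMod n)) : Finset (Sym2 (ZMod n)) :=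
  Finset.univ.filter (fun f => ∀ x y, f = s(x, y) → link nx x y)

lemma mem_Lset {nx : Equiv.Perm (ZMod n)} {x y : ZMod n} :
    s(x, y) ∈ Lset nx ↔ link nx x y := by
  unfold Lset
  rw [Finset.mem_filter]
  constructor
  · intro h; exact h.2 x y rfl
  · intro h
    refine ⟨Finset.mem_univ _, fun u v huv => ?_⟩
    rw [Sym2.eq_iff] at huv
    rcases huv with ⟨rfl, rfl⟩ | ⟨rfl, rfl⟩
    · exact h
    · exact h.symm

lemma IsDiag_iff {nx : Equiv.Perm (ZMod n)} {D : Set (Sym2 (ZMod n))} :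
    IsDiag nx D ↔ ∀ f ∈ D, f ∈ Lset nx := by
  constructor
  · intro h f
    induction f using Sym2.ind with
    | _ x y => intro hf; exact mem_Lset.2 (h x y hf)
  · intro h x y hxy
    exact mem_Lset.1 (h _ hxy)

/-- The finite set of pairs of distinct curves. -/
def Aset (nx : Equiv.Perm (ZMod n)) : Finset (Sym2 (ZMod n)) :=
  Finset.univ.filter (fun f => ∃ x y, f = s(x, y) ∧ x ≠ y ∧ act nx 0 x ∧ act nx 0 y)

/-- Linkable pairs not in `D`. -/
def Cset (nx : Equiv.Perm (ZMod n)) (D : Set (Sym2 (ZMod n))) : Finset (Sym2 (ZMod n)) :=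
  (Lset nx).filter (fun f => f ∉ D)

lemma mem_Cset {nx : Equiv.Perm (ZMod n)} {D : Set (Sym2 (ZMod n))} {f : Sym2 (ZMod n)} :
    f ∈ Cset nx D ↔ f ∈ Lset nx ∧ f ∉ D := by
  unfold Cset; exact Finset.mem_filter

lemma lbl_mem {nx : Equiv.Perm (ZMod n)} (hn : Adm nx) {D : Set (Sym2 (ZMod n))}
    (hD : IsDiag nx D) {f : Sym2 (ZMod n)} (hf : f ∈ Lset nx) : lbl nx D f ∈ Aset nx := by
  induction f using Sym2.ind with
  | _ x y =>
    have h := mem_Lset.1 hf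
    unfold Aset
    rw [Finset.mem_filter]
    refine ⟨Finset.mem_univ _, _, _, rfl, ?_, act_lbl hn hD h⟩
    exact fun e => h.ne ((Equiv.injective _) e)

lemma lbl_surj {nx : Equiv.Perm (ZMod n)} (hn : Adm nx) {D : Set (Sym2 (ZMod n))}
    (hD : Good nx D) {p : Sym2 (ZMod n)} (hp : p ∈ Aset nx) :
    ∃ f ∈ Cset nx D, lbl nx D f = p := by
  unfold Aset at hp
  rw [Finset.mem_filter] at hp
  obtain ⟨-, x, y, rfl, hxy, hx, hy⟩ := hp
  obtain ⟨k, hk, hl, hs, hnd⟩ := crossing hn hD hx hy hxy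
  refine ⟨s(T nx D k x, T nx D k y), ?_, ?_⟩
  · rw [mem_Cset]
    exact ⟨mem_Lset.2 hl, hnd⟩
  · unfold lbl
    rw [idx_uniq _ _ k hk hs.symm]
    simp

lemma card_good {nx : Equiv.Perm (ZMod n)} (hn : Adm nx) {D : Set (Sym2 (ZMod n))}
    (hD : Good nx D) : (Aset nx).card ≤ (Cset nx D).card := by
  apply Finset.card_le_card_of_surjOn (lbl nx D)
  intro p hp
  obtain ⟨f, hf, h⟩ := lbl_surj hn hD hp
  exact ⟨f, hf, h⟩

lemma mem_tog {D : Set (Sym2 (ZMod n))} {f g : Sym2 (ZMod n)} :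
    g ∈ tog D f ↔ (g ∈ D ∧ g ≠ f) ∨ (g ∉ D ∧ g = f) := Iff.rfl

lemma lbl_inj {nx : Equiv.Perm (ZMod n)} (hn : Adm nx) {D : Set (Sym2 (ZMod n))}
    (hD : Good nx D) (hmax : ∀ D', D ⊂ D' → ¬ Good nx D') :
    Set.InjOn (lbl nx D) (Cset nx D) := by
  intro f hf g hg hfg
  by_contra hne
  have hf' := (mem_Cset.1 hf)
  have hg' := (mem_Cset.1 hg)
  clear hf hg
  induction f using Sym2.ind with
  | _ x y =>
  induction g using Sym2.ind with
  | _ z w =>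
  have := (good_tog2 hn hD (mem_Lset.1 hf'.1) (mem_Lset.1 hg'.1)).2 hfg.symm
  refine hmax _ ?_ this
  rw [Set.ssubset_iff_of_subset]
  · refine ⟨s(x, y), ?_, hf'.2⟩
    left
    refine ⟨Or.inr ⟨hf'.2, rfl⟩, hne⟩
  · intro p hp
    have h1 : p ≠ s(x, y) := by rintro rfl; exact hf'.2 hp
    have h2 : p ≠ s(z, w) := by rintro rfl; exact hg'.2 hp
    exact Or.inl ⟨Or.inl ⟨hp, h1⟩, h2⟩

theorem comb_main {nx : Equiv.Perm (ZMod n)} (hn : Adm nx) {D : Set (Sym2 (ZMod n))}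
    (hD : Good nx D) (hmax : ∀ D', D ⊂ D' → ¬ Good nx D') (e : Sym2 (ZMod n)) (he : e ∈ D) :
    ∃! f : Sym2 (ZMod n), f ∉ D ∧ Good nx ((D \ {e}) ∪ {f}) ∧
      ∀ D', (D \ {e}) ∪ {f} ⊂ D' → ¬ Good nx D' := by
  have heL := IsDiag_iff.1 hD.1 e he
  obtain ⟨f, hfC, hfl⟩ := lbl_surj hn hD (lbl_mem hn hD.1 heL)
  have hf' := mem_Cset.1 hfC
  have key : ∀ g : Sym2 (ZMod n), g ∉ D → (D \ {e}) ∪ {g} = tog (tog D e) g := by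
    intro g hg
    have hge : g ≠ e := by rintro rfl; exact hg he
    ext p
    simp only [mem_tog, Set.mem_union, Set.mem_sdiff, Set.mem_singleton_iff]
    by_cases h1 : p = g
    · subst h1; tauto
    · by_cases h2 : p = e
      · subst h2; tauto
      · tauto
  have hgood : ∀ g ∈ Lset nx, g ∉ D → (Good nx ((D \ {e}) ∪ {g}) ↔ lbl nx D g = lbl nx D e) := by
    intro g hgL hg
    rw [key g hg]
    clear key hfl hfC
    induction e using Sym2.ind with
    | _ x y =>
    induction g using Sym2.ind with
    | _ z w =>
    exact good_tog2 hn hD (mem_Lset.1 heL) (mem_Lset.1 hgL)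
  refine ⟨f, ⟨hf'.2, (hgood f hf'.1 hf'.2).2 hfl, ?_⟩, ?_⟩
  · intro D' hss hG
    have h1 := card_good hn hG
    have h2 : (Cset nx D).card ≤ (Aset nx).card :=
      Finset.card_le_card_of_injOn (lbl nx D)
        (fun f hf => lbl_mem hn hD.1 (mem_Cset.1 hf).1) (lbl_inj hn hD hmax)
    -- Cset of the flipped set
    have h3 : Cset nx ((D \ {e}) ∪ {f}) = insert e ((Cset nx D).erase f) := by
      have hef : e ≠ f := by rintro rfl; exact hf'.2 he
      ext p
      simp only [mem_Cset, Finset.mem_insert, Finset.mem_erase, Set.mem_union,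
        Set.mem_sdiff, Set.mem_singleton_iff]
      by_cases hpe : p = e
      · subst hpe; tauto
      · tauto
    have h4 : (Cset nx ((D \ {e}) ∪ {f})).card = (Cset nx D).card := by
      rw [h3, Finset.card_insert_of_notMem, Finset.card_erase_of_mem hfC]
      · have := Finset.card_pos.2 ⟨f, hfC⟩
        omega
      · simp [mem_Cset, he]
    have h5 : (Cset nx D').card < (Cset nx ((D \ {e}) ∪ {f})).card := by
      apply Finset.card_lt_card
      obtain ⟨p, hp, hp'⟩ := Set.exists_of_ssubset hss
      rw [Finset.ssubset_iff_of_subset]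
      · refine ⟨p, ?_, ?_⟩
        · exact mem_Cset.2 ⟨IsDiag_iff.1 hG.1 p hp, hp'⟩
        · intro h; exact (mem_Cset.1 h).2 hp
      · intro q hq
        have := mem_Cset.1 hq
        exact mem_Cset.2 ⟨this.1, fun h => this.2 (hss.1 h)⟩
    omega
  · rintro g ⟨hg, hG, -⟩
    have hgL := IsDiag_iff.1 hG.1 g (Or.inr rfl)
    have := (hgood g hgL hg).1 hG
    exact lbl_inj hn hD hmax (mem_Cset.2 ⟨hgL, hg⟩) hfC (this.trans hfl.symm)

end SD

namespace SD

variable {n : ℕ} [NeZero n]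

/-- A closed path, started right after a jump. -/
structure Path (nx : Equiv.Perm (ZMod n)) (τ : ZMod n) (r : ℕ → ZMod n) : Prop where
  act : ∀ s : ℕ, act nx (τ + s) (r s)
  step : ∀ s : ℕ, r (s + 1) = r s ∨ r (s + 1) = τ + s + 1 - r s
  per : r n = r 0
  lst : r 0 + r (n - 1) = τ ∧ r (n - 1) ≠ r 0

/-- which of the two chord ends is the pivot -/
def fl (r : ℕ → ZMod n) : ℕ → Prop
  | 0 => False
  | s + 1 => ¬ (fl r s ↔ r (s + 1) ≠ r s)

def aa (r : ℕ → ZMod n) : ℕ → ℤ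
  | 0 => (r 0).val
  | s + 1 => if fl r s then aa r s + 1 else aa r s

def bb (r : ℕ → ZMod n) : ℕ → ℤ
  | 0 => (r 0).val + (r (n - 1) - r 0).val
  | s + 1 => if fl r s then bb r s else bb r s + 1

lemma cast_val_sub (x y : ZMod n) : (((x - y).val : ℤ) : ZMod n) = x - y := by simp

lemma lat_inv {nx : Equiv.Perm (ZMod n)} (hn : Adm nx) {τ : ZMod n} {r : ℕ → ZMod n}
    (hp : Path nx τ r) (s : ℕ) :
    (aa r s + bb r s = aa r 0 + bb r 0 + s) ∧ (aa r 0 ≤ aa r s) ∧ (bb r 0 ≤ bb r s) ∧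
    (¬ fl r s → r s = (aa r s : ZMod n) ∧ bb r s - aa r s = (τ + s - r s - r s).val) ∧
    (fl r s → r s = (bb r s : ZMod n) ∧ aa r s + n - bb r s = (τ + s - r s - r s).val ∧
      bb r 0 < bb r s) := by
  induction s with
  | zero =>
    refine ⟨by simp, le_rfl, le_rfl, fun _ => ⟨by simp [aa], ?_⟩, fun h => absurd h id⟩
    simp only [aa, bb]
    have : τ + (0 : ℕ) - r 0 - r 0 = r (n - 1) - r 0 := by rw [← hp.lst.1]; push_cast; ring
    rw [this]; ring
  | succ s ih =>
    obtain ⟨i1, i2, i3, i4, i5⟩ := ih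
    have hm := act_move hn (hp.act s)
    have hm' : (τ + (s + 1 : ℕ) - r s - r s).val = (τ + s - r s - r s).val + 1 := by
      rw [← hm]; congr 1; push_cast; ring
    by_cases hf : fl r s
    · obtain ⟨j1, j2, j3⟩ := i5 hf
      have ea : aa r (s + 1) = aa r s + 1 := by simp [aa, hf]
      have eb : bb r (s + 1) = bb r s := by simp [bb, hf]
      refine ⟨by rw [ea, eb]; push_cast; omega, by omega, by omega, ?_, ?_⟩
      · intro h
        have hj : r (s + 1) ≠ r s := by simpa [fl, hf] using h
        have hr := (hp.step s).resolve_left hj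
        have hsum : ((aa r s + bb r s : ℤ) : ZMod n) = τ + s := by
          rw [i1]; simp only [aa, bb]; push_cast; rw [← hp.lst.1]; simp
        constructor
        · rw [hr, ea, j1, ← hsum]; push_cast; ring
        · have e1 : τ + (s + 1 : ℕ) - r (s + 1) - r (s + 1) = r s - r (s + 1) := by
            rw [hr]; push_cast; ring
          have e2 : τ + (s + 1 : ℕ) - r s - r s = r (s + 1) - r s := by
            rw [hr]; push_cast; ring
          have := vneg _ _ hj
          rw [e1]; rw [e2] at hm'
          rw [ea, eb]
          omega
      · intro h
        have hj : r (s + 1) = r s := by simpa [fl, hf] using h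
        rw [hj, eb, ea, hm']
        refine ⟨j1, by push_cast; omega, j3⟩
    · obtain ⟨j1, j2⟩ := i4 hf
      have ea : aa r (s + 1) = aa r s := by simp [aa, hf]
      have eb : bb r (s + 1) = bb r s + 1 := by simp [bb, hf]
      refine ⟨by rw [ea, eb]; push_cast; omega, by omega, by omega, ?_, ?_⟩
      · intro h
        have hj : r (s + 1) = r s := by simpa [fl, hf] using h
        rw [hj, eb, ea, hm']
        refine ⟨j1, by push_cast; omega⟩
      · intro h
        have hj : r (s + 1) ≠ r s := by simpa [fl, hf] using h
        have hr := (hp.step s).resolve_left hj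
        have hsum : ((aa r s + bb r s : ℤ) : ZMod n) = τ + s := by
          rw [i1]; simp only [aa, bb]; push_cast; rw [← hp.lst.1]; simp
        refine ⟨?_, ?_, by omega⟩
        · rw [hr, eb, j1, ← hsum]; push_cast; ring
        · have e1 : τ + (s + 1 : ℕ) - r (s + 1) - r (s + 1) = r s - r (s + 1) := by
            rw [hr]; push_cast; ring
          have e2 : τ + (s + 1 : ℕ) - r s - r s = r (s + 1) - r s := by
            rw [hr]; push_cast; ring
          have := vneg _ _ hj
          rw [e1]; rw [e2] at hm'
          rw [ea, eb]
          omega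

lemma aa_mono (r : ℕ → ZMod n) : Monotone (aa r) := by
  apply monotone_nat_of_le_succ
  intro s
  simp only [aa]; split_ifs <;> omega

lemma bb_mono (r : ℕ → ZMod n) : Monotone (bb r) := by
  apply monotone_nat_of_le_succ
  intro s
  simp only [bb]; split_ifs <;> omega

lemma cong_small {X Y : ℤ} (h : (X : ZMod n) = (Y : ZMod n)) (h1 : X - Y < n) (h2 : -n < X - Y) :
    X = Y := by
  have h3 := (cast_dvd (n := n) X Y).2 h.symm
  obtain ⟨k, hk⟩ := h3
  have hn := npos' (n := n)
  have : k = 0 := by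
    have : k < 1 := by nlinarith
    have : -1 < k := by nlinarith
    omega
  rw [this, mul_zero] at hk
  omega

lemma start_lt {nx : Equiv.Perm (ZMod n)} {τ : ZMod n} {r : ℕ → ZMod n}
    (hp : Path nx τ r) : aa r 0 < bb r 0 ∧ bb r 0 < aa r 0 + n := by
  have h1 := (vpos (r (n - 1)) (r 0)).2 hp.lst.2
  have h2 := ZMod.val_lt (r (n - 1) - r 0)
  simp only [aa, bb]
  omega

lemma lat_end {nx : Equiv.Perm (ZMod n)} (hn : Adm nx) {τ : ZMod n} {r : ℕ → ZMod n}
    (hp : Path nx τ r) : fl r n ∧ aa r n = bb r 0 ∧ bb r n = aa r 0 + n := by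
  obtain ⟨h1, h2⟩ := start_lt hp
  obtain ⟨i1, i2, i3, i4, i5⟩ := lat_inv hn hp n
  have hv := ZMod.val_lt (τ + (n : ZMod n) - r n - r n)
  have ha0 : ((aa r 0 : ℤ) : ZMod n) = r 0 := by simp [aa]
  by_cases hf : fl r n
  · obtain ⟨j1, j2, j3⟩ := i5 hf
    have : bb r n = aa r 0 + n := by
      apply cong_small (n := n)
      · rw [← j1, hp.per, ← ha0]; push_cast; simp
      · omega
      · omega
    exact ⟨hf, by omega, this⟩
  · exfalso
    obtain ⟨j1, j2⟩ := i4 hf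
    rw [hp.per, ← ha0] at j1
    by_cases h : aa r n < aa r 0 + n
    · have := cong_small (n := n) j1 (by omega) (by omega)
      omega
    · omega

/-- description of the entries -/
lemma entry_cases {nx : Equiv.Perm (ZMod n)} (hn : Adm nx) {τ : ZMod n} {r : ℕ → ZMod n}
    (hp : Path nx τ r) (s : ℕ) (hs : s < n) (hj : r (s + 1) ≠ r s) :
    (fl r (s + 1) ∧ r (s + 1) = (bb r (s + 1) : ZMod n) ∧ r s = (aa r (s + 1) : ZMod n) ∧
      bb r (s + 1) = bb r s + 1 ∧ bb r 0 < bb r (s + 1) ∧ bb r (s + 1) ≤ aa r 0 + n ∧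
      aa r 0 ≤ aa r (s + 1) ∧ (bb r (s + 1) < aa r 0 + n → aa r (s + 1) < bb r 0)) ∨
    (¬ fl r (s + 1) ∧ r (s + 1) = (aa r (s + 1) : ZMod n) ∧ r s = (bb r (s + 1) : ZMod n) ∧
      aa r (s + 1) = aa r s + 1 ∧ aa r 0 < aa r (s + 1) ∧ aa r (s + 1) ≤ bb r 0 ∧
      bb r 0 < bb r (s + 1) ∧ bb r (s + 1) < aa r 0 + n) := by
  obtain ⟨e1, e2, e3⟩ := lat_end hn hp
  obtain ⟨i1, i2, i3, i4, i5⟩ := lat_inv hn hp s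
  obtain ⟨k1, k2, k3, k4, k5⟩ := lat_inv hn hp (s + 1)
  have ma := aa_mono r (show s + 1 ≤ n by omega)
  have mb := bb_mono r (show s + 1 ≤ n by omega)
  by_cases hf : fl r s
  · right
    have hf' : ¬ fl r (s + 1) := by simp [fl, hf, hj]
    have hsn : s + 1 ≠ n := by intro h; rw [h] at hf'; exact hf' e1
    have mb2 := bb_mono r (show s + 1 + 1 ≤ n by omega)
    have eb2 : bb r (s + 1 + 1) = bb r (s + 1) + 1 := by
      rw [bb]; rw [if_neg hf']
    have ea : aa r (s + 1) = aa r s + 1 := by simp [aa, hf]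
    have eb : bb r (s + 1) = bb r s := by simp [bb, hf]
    refine ⟨hf', (k4 hf').1, by rw [eb]; exact (i5 hf).1, ea, by omega, by omega, ?_, by omega⟩
    rw [eb]; exact (i5 hf).2.2
  · left
    have hf' : fl r (s + 1) := by simp [fl, hf, hj]
    have ea : aa r (s + 1) = aa r s := by simp [aa, hf]
    have eb : bb r (s + 1) = bb r s + 1 := by simp [bb, hf]
    refine ⟨hf', (k5 hf').1, by rw [ea]; exact (i4 hf).1, eb, (k5 hf').2.2, by omega, by omega, ?_⟩
    intro hlt
    have hsn : s + 1 ≠ n := by intro h; rw [h] at hlt; omega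
    have ma2 := aa_mono r (show s + 1 + 1 ≤ n by omega)
    have ea2 : aa r (s + 1 + 1) = aa r (s + 1) + 1 := by
      rw [aa]; rw [if_pos hf']
    omega

/-- Each vertex is entered at most once. -/
lemma entry_unique {nx : Equiv.Perm (ZMod n)} (hn : Adm nx) {τ : ZMod n} {r : ℕ → ZMod n}
    (hp : Path nx τ r) {s s' : ℕ} (hs : s < n) (hs' : s' < n) (hj : r (s + 1) ≠ r s)
    (hj' : r (s' + 1) ≠ r s') (h : r (s + 1) = r (s' + 1)) : s = s' := by
  obtain ⟨h1, h2⟩ := start_lt hp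
  rcases entry_cases hn hp s hs hj with ⟨-, a1, a2, a3, a4, a5, a6, a7⟩ |
    ⟨-, a1, a2, a3, a4, a5, a6, a7⟩ <;>
  rcases entry_cases hn hp s' hs' hj' with ⟨-, b1, b2, b3, b4, b5, b6, b7⟩ |
    ⟨-, b1, b2, b3, b4, b5, b6, b7⟩
  · have := cong_small (n := n) (a1.symm.trans (h.trans b1)) (by omega) (by omega)
    rcases lt_trichotomy s s' with hl | hl | hl
    · have := bb_mono r (show s + 1 ≤ s' by omega); omega
    · exact hl
    · have := bb_mono r (show s' + 1 ≤ s by omega); omega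
  · have := cong_small (n := n) (a1.symm.trans (h.trans b1)) (by omega) (by omega)
    omega
  · have := cong_small (n := n) (a1.symm.trans (h.trans b1)) (by omega) (by omega)
    omega
  · have := cong_small (n := n) (a1.symm.trans (h.trans b1)) (by omega) (by omega)
    rcases lt_trichotomy s s' with hl | hl | hl
    · have := aa_mono r (show s + 1 ≤ s' by omega); omega
    · exact hl
    · have := aa_mono r (show s' + 1 ≤ s by omega); omega

lemma val_of_lift {x u : ZMod n} {X U : ℤ} (hx : x = (X : ZMod n)) (hu : u = (U : ZMod n))
    (h1 : U ≤ X) (h2 : X < U + n) : ((x - u).val : ℤ) = X - U := by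
  have hlt := ZMod.val_lt (x - u)
  apply cong_small (n := n)
  · rw [cast_val_sub, hx, hu]; push_cast; ring
  · omega
  · omega

/-- Edges of the closed path interlace with the initial edge. -/
lemma interlace {nx : Equiv.Perm (ZMod n)} (hn : Adm nx) {τ : ZMod n} {r : ℕ → ZMod n}
    (hp : Path nx τ r) (s : ℕ) (hs : s < n) (hj : r (s + 1) ≠ r s) :
    (0 < (r (s + 1) - r 0).val → (r (s + 1) - r 0).val ≤ (r (n - 1) - r 0).val →
      (r (n - 1) - r 0).val < (r s - r 0).val) ∧
    ((r (n - 1) - r 0).val < (r (s + 1) - r 0).val →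
      (r s - r 0).val < (r (n - 1) - r 0).val) := by
  obtain ⟨h1, h2⟩ := start_lt hp
  have ha0 : r 0 = ((aa r 0 : ℤ) : ZMod n) := by simp [aa]
  have hV : ((r (n - 1) - r 0).val : ℤ) = bb r 0 - aa r 0 := by simp [aa, bb]
  rcases entry_cases hn hp s hs hj with ⟨-, a1, a2, a3, a4, a5, a6, a7⟩ |
    ⟨-, a1, a2, a3, a4, a5, a6, a7⟩
  · by_cases hb : bb r (s + 1) < aa r 0 + n
    · have a7 := a7 hb
      have e1 := val_of_lift a1 ha0 (by omega) (by omega)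
      have e2 := val_of_lift a2 ha0 (by omega) (by omega)
      omega
    · have : bb r (s + 1) = aa r 0 + n := by omega
      have : r (s + 1) = r 0 := by rw [a1, this, ha0]; push_cast; simp
      rw [this]; simp
  · have e1 := val_of_lift a1 ha0 (by omega) (by omega)
    have e2 := val_of_lift a2 ha0 (by omega) (by omega)
    omega

end SD

namespace SD

variable {n : ℕ} [NeZero n]

/-- The edges of the trajectory of `x`: an edge `u → v` means a jump from `v` to `u`. -/
def Edg (nx : Equiv.Perm (ZMod n)) (D : Set (Sym2 (ZMod n))) (x u v : ZMod n) : Prop :=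
  ∃ t : ℕ, T nx D (t + 1) x = u ∧ T nx D t x = v ∧ u ≠ v

lemma T_per {nx : Equiv.Perm (ZMod n)} {D : Set (Sym2 (ZMod n))} (hD : Good nx D)
    {x : ZMod n} (hx : act nx 0 x) (t : ℕ) : T nx D (t + n) x = T nx D t x := by
  induction t with
  | zero => rw [zero_add]; exact hD.2 x hx
  | succ t ih =>
    have e : t + 1 + n = (t + n) + 1 := by ring
    rw [e, T_succ, T_succ, ih]
    congr 2
    push_cast; simp

lemma T_per' {nx : Equiv.Perm (ZMod n)} {D : Set (Sym2 (ZMod n))} (hD : Good nx D)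
    {x : ZMod n} (hx : act nx 0 x) (t m : ℕ) : T nx D (t + n * m) x = T nx D t x := by
  induction m with
  | zero => simp
  | succ m ih => rw [mul_add, mul_one, ← add_assoc, T_per hD hx, ih]

lemma T_congr {nx : Equiv.Perm (ZMod n)} {D : Set (Sym2 (ZMod n))} (hD : Good nx D)
    {x : ZMod n} (hx : act nx 0 x) {t t' : ℕ} (h : (t : ZMod n) = (t' : ZMod n)) :
    T nx D t x = T nx D t' x := by
  rw [← Nat.mod_add_div t n, ← Nat.mod_add_div t' n, T_per' hD hx, T_per' hD hx]
  have := (ZMod.natCast_eq_natCast_iff' t t' n).1 h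
  rw [this]

lemma jump_iff {nx : Equiv.Perm (ZMod n)} (hn : Adm nx) {D : Set (Sym2 (ZMod n))}
    {t y : ZMod n} (h : act nx t y) : stp nx D (t + 1) y ≠ y ↔ jmp nx D (t + 1) y := by
  have hm := act_move hn h
  constructor
  · intro h1
    by_contra h2
    exact h1 (stp_of_not h2)
  · intro h1 h2
    rw [stp_of_jmp h1] at h2
    rw [h2] at hm
    simp at hm

lemma T_jump {nx : Equiv.Perm (ZMod n)} (hn : Adm nx) {D : Set (Sym2 (ZMod n))} (hD : Good nx D)
    {x : ZMod n} (hx : act nx 0 x) {t : ℕ} (h : T nx D (t + 1) x ≠ T nx D t x) :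
    jmp nx D (t + 1) (T nx D t x) ∧ T nx D (t + 1) x = t + 1 - T nx D t x := by
  rw [T_succ] at h ⊢
  push_cast at h ⊢
  have := (jump_iff hn ((act_T hn hD.1 t x).2 hx)).1 h
  exact ⟨this, stp_of_jmp this⟩

lemma T_path {nx : Equiv.Perm (ZMod n)} (hn : Adm nx) {D : Set (Sym2 (ZMod n))} (hD : Good nx D)
    {x : ZMod n} (hx : act nx 0 x) {t : ℕ} (h : T nx D (t + 1) x ≠ T nx D t x) :
    Path nx ((t : ZMod n) + 1) (fun s => T nx D (t + 1 + s) x) := by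
  have hnp : 0 < n := NeZero.pos n
  have e0 : T nx D (t + 1 + (n - 1)) x = T nx D t x := by
    rw [show t + 1 + (n - 1) = t + n by omega, T_per hD hx]
  refine ⟨?_, ?_, ?_, ?_⟩
  · intro s
    have := (act_T hn hD.1 (t + 1 + s) x).2 hx
    push_cast at this
    exact this
  · intro s
    by_cases h' : T nx D (t + 1 + s + 1) x = T nx D (t + 1 + s) x
    · left; exact h'
    · right
      have := (T_jump hn hD hx h').2
      push_cast at this
      exact this
  · exact T_per hD hx _
  · show T nx D (t + 1) x + T nx D (t + 1 + (n - 1)) x = _ ∧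
      T nx D (t + 1 + (n - 1)) x ≠ T nx D (t + 1) x
    rw [e0]
    refine ⟨?_, h.symm⟩
    rw [(T_jump hn hD hx h).2]; ring

/-- reindexing an edge along a path -/
lemma edg_reidx {nx : Equiv.Perm (ZMod n)} {D : Set (Sym2 (ZMod n))} (hD : Good nx D)
    {x : ZMod n} (hx : act nx 0 x) (t : ℕ) (t' : ℕ) :
    ∃ s < n, ((t + 1 + s : ℕ) : ZMod n) = t' ∧ T nx D (t + 1 + s) x = T nx D t' x ∧
      T nx D (t + 1 + (s + 1)) x = T nx D (t' + 1) x := by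
  refine ⟨((t' : ZMod n) - t - 1).val, ZMod.val_lt _, ?_, ?_, ?_⟩
  · push_cast; rw [ZMod.natCast_val, ZMod.cast_id]; ring
  · apply T_congr hD hx
    push_cast; rw [ZMod.natCast_val, ZMod.cast_id]; ring
  · apply T_congr hD hx
    push_cast; rw [ZMod.natCast_val, ZMod.cast_id]; ring

lemma edg_out_unique {nx : Equiv.Perm (ZMod n)} (hn : Adm nx) {D : Set (Sym2 (ZMod n))}
    (hD : Good nx D) {x : ZMod n} (hx : act nx 0 x) {u v v' : ZMod n}
    (h : Edg nx D x u v) (h' : Edg nx D x u v') : v = v' := by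
  have hnp : 0 < n := NeZero.pos n
  obtain ⟨t, h1, h2, h3⟩ := h
  obtain ⟨t', h1', h2', h3'⟩ := h'
  have hj : T nx D (t + 1) x ≠ T nx D t x := by rw [h1, h2]; exact h3
  have hp := T_path hn hD hx hj
  obtain ⟨s, hs, -, e1, e2⟩ := edg_reidx hD hx t t'
  have e0 : T nx D (t + 1 + (n - 1)) x = T nx D t x := by
    rw [show t + 1 + (n - 1) = t + n by omega, T_per hD hx]
  have e0' : T nx D (t + 1 + (n - 1 + 1)) x = T nx D (t + 1) x := by
    rw [show t + 1 + (n - 1 + 1) = t + 1 + n by omega, T_per hD hx]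
  have := entry_unique hn hp (s := n - 1) (s' := s) (by omega) hs
    (by show T nx D (t + 1 + (n - 1 + 1)) x ≠ T nx D (t + 1 + (n - 1)) x
        rw [e0, e0']; exact hj)
    (by show T nx D (t + 1 + (s + 1)) x ≠ T nx D (t + 1 + s) x
        rw [e1, e2, h1', h2']; exact h3')
    (by show T nx D (t + 1 + (n - 1 + 1)) x = T nx D (t + 1 + (s + 1)) x
        rw [e0', e2, h1, h1'])
  rw [← h2, ← e0, this, e1, h2']

def VS (nx : Equiv.Perm (ZMod n)) (D : Set (Sym2 (ZMod n))) (x : ZMod n) : Finset (ZMod n) :=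
  Finset.univ.filter (fun z => ∃ t : ℕ, T nx D t x = z)

lemma mem_VS {nx : Equiv.Perm (ZMod n)} {D : Set (Sym2 (ZMod n))} {x z : ZMod n} :
    z ∈ VS nx D x ↔ ∃ t : ℕ, T nx D t x = z := by simp [VS]

lemma edg_mem {nx : Equiv.Perm (ZMod n)} {D : Set (Sym2 (ZMod n))} {x u v : ZMod n}
    (h : Edg nx D x u v) : u ∈ VS nx D x ∧ v ∈ VS nx D x := by
  obtain ⟨t, h1, h2, h3⟩ := h
  exact ⟨mem_VS.2 ⟨_, h1⟩, mem_VS.2 ⟨_, h2⟩⟩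

lemma not_act_self {nx : Equiv.Perm (ZMod n)} (hn : Adm nx) {t z : ZMod n} (h : t = z + z) :
    ¬ act nx t z := by
  intro h1
  have h2 := h1.1
  have h3 := hn.pos z
  rw [h] at h2
  simp at h2
  simp [h2] at h3

lemma edg_out_exists {nx : Equiv.Perm (ZMod n)} (hn : Adm nx) {D : Set (Sym2 (ZMod n))}
    (hD : Good nx D) {x : ZMod n} (hx : act nx 0 x) {u : ZMod n} (hu : u ∈ VS nx D x) :
    ∃ v, Edg nx D x u v := by
  obtain ⟨t, ht⟩ := mem_VS.1 hu
  by_contra hcon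
  push Not at hcon
  have key : ∀ j : ℕ, j ≤ t + n → T nx D (t + n - j) x = u := by
    intro j
    induction j with
    | zero => intro _; rw [Nat.sub_zero, T_per hD hx, ht]
    | succ j ih =>
      intro hj
      have h1 := ih (by omega)
      by_contra h2
      apply hcon (T nx D (t + n - (j + 1)) x)
      refine ⟨t + n - (j + 1), ?_, rfl, fun h => h2 h.symm⟩
      rw [← h1]; congr 2; omega
  have hj := ZMod.val_lt ((t : ZMod n) - u - u)
  have h1 := key ((t : ZMod n) - u - u).val (by omega)
  have h2 := (act_T hn hD.1 (t + n - ((t : ZMod n) - u - u).val) x).2 hx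
  rw [h1] at h2
  refine not_act_self hn ?_ h2
  rw [Nat.cast_sub (by omega)]
  push_cast; rw [ZMod.natCast_val, ZMod.cast_id, ZMod.natCast_self]; ring

lemma edg_in_exists {nx : Equiv.Perm (ZMod n)} (hn : Adm nx) {D : Set (Sym2 (ZMod n))}
    (hD : Good nx D) {x : ZMod n} (hx : act nx 0 x) {t : ℕ} {v : ZMod n}
    (ht : T nx D t x = v) :
    ∃ m : ℕ, (∀ j ≤ m, T nx D (t + j) x = v) ∧ T nx D (t + m + 1) x ≠ v := by
  have hex : ∃ m : ℕ, T nx D (t + m + 1) x ≠ v := by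
    by_contra hcon
    push Not at hcon
    have key : ∀ j : ℕ, T nx D (t + j) x = v := by
      intro j
      cases j with
      | zero => simpa using ht
      | succ j => exact hcon j
    have h1 := key (v + v - (t : ZMod n)).val
    have h2 := (act_T hn hD.1 (t + (v + v - (t : ZMod n)).val) x).2 hx
    rw [h1] at h2
    refine not_act_self hn ?_ h2
    push_cast; rw [ZMod.natCast_val, ZMod.cast_id]; simp
  refine ⟨Nat.find hex, ?_, Nat.find_spec hex⟩
  intro j hj
  cases j with
  | zero => simpa using ht
  | succ j =>
    have := Nat.find_min hex (m := j) (by omega)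
    push Not at this
    exact this

/-- the out-neighbour on a trajectory -/
lemma edg_in_unique {nx : Equiv.Perm (ZMod n)} (hn : Adm nx) {D : Set (Sym2 (ZMod n))}
    (hD : Good nx D) {x : ZMod n} (hx : act nx 0 x) {u u' v : ZMod n}
    (h : Edg nx D x u v) (h' : Edg nx D x u' v) : u = u' := by
  choose! f hf using fun u (hu : u ∈ VS nx D x) => edg_out_exists hn hD hx hu
  let F : {z // z ∈ VS nx D x} → {z // z ∈ VS nx D x} := fun z => ⟨f z, (edg_mem (hf z z.2)).2⟩
  have hs : Function.Surjective F := by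
    rintro ⟨v, hv⟩
    obtain ⟨t, ht⟩ := mem_VS.1 hv
    obtain ⟨m, h1, h2⟩ := edg_in_exists hn hD hx ht
    have he : Edg nx D x (T nx D (t + m + 1) x) v := ⟨t + m, rfl, h1 m le_rfl, h2⟩
    refine ⟨⟨_, (edg_mem he).1⟩, ?_⟩
    apply Subtype.ext
    exact edg_out_unique hn hD hx (hf _ (edg_mem he).1) he
  have hi := Finite.injective_iff_surjective.2 hs
  have a := @hi ⟨u, (edg_mem h).1⟩ ⟨u', (edg_mem h').1⟩ (by
    apply Subtype.ext
    show f u = f u'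
    rw [edg_out_unique hn hD hx (hf _ (edg_mem h).1) h,
      edg_out_unique hn hD hx (hf _ (edg_mem h').1) h'])
  exact congrArg Subtype.val a

lemma edg_in {nx : Equiv.Perm (ZMod n)} (hn : Adm nx) {D : Set (Sym2 (ZMod n))}
    (hD : Good nx D) {x : ZMod n} (hx : act nx 0 x) {v : ZMod n} (hv : v ∈ VS nx D x) :
    ∃ u, Edg nx D x u v := by
  obtain ⟨t, ht⟩ := mem_VS.1 hv
  obtain ⟨m, h1, h2⟩ := edg_in_exists hn hD hx ht
  exact ⟨_, t + m, rfl, h1 m le_rfl, h2⟩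

lemma edg_turn {nx : Equiv.Perm (ZMod n)} (hn : Adm nx) {D : Set (Sym2 (ZMod n))}
    (hD : Good nx D) {x : ZMod n} (hx : act nx 0 x) {u v w : ZMod n}
    (h : Edg nx D x u v) (h' : Edg nx D x v w) :
    (w - v).val < (u - v).val ∧ ∀ z, s(v, z) ∈ D →
      ¬ ((w - v).val < (z - v).val ∧ (z - v).val < (u - v).val) := by
  obtain ⟨t, h1, h2, h3⟩ := h'
  have hj : T nx D (t + 1) x ≠ T nx D t x := by rw [h1, h2]; exact h3
  have hw := (T_jump hn hD hx hj).2
  rw [h1, h2] at hw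
  obtain ⟨m, k1, k2⟩ := edg_in_exists hn hD hx h1
  have hu : T nx D (t + 1 + m + 1) x = u :=
    edg_in_unique hn hD hx ⟨t + 1 + m, rfl, k1 m le_rfl, k2⟩ h
  have hmv : ∀ j ≤ m + 1, (((t + 1 + j : ℕ) : ZMod n) - v - v).val = (w - v).val + j := by
    intro j
    induction j with
    | zero =>
      intro _
      have : ((t + 1 + 0 : ℕ) : ZMod n) - v - v = w - v := by
        have : w = t + 1 - v := by rw [hw]; ring
        rw [this]; push_cast; ring
      rw [this]; rfl
    | succ j ih =>
      intro hj
      have a := (act_T hn hD.1 (t + 1 + j) x).2 hx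
      rw [k1 j (by omega)] at a
      have b := act_move hn a
      rw [ih (by omega)] at b
      rw [← add_assoc, ← add_assoc, ← b]
      congr 1
      push_cast; ring
  have hj2 : T nx D (t + 1 + m + 1) x ≠ T nx D (t + 1 + m) x := by
    rw [k1 m le_rfl]; exact k2
  have hu2 := (T_jump hn hD hx hj2).2
  rw [hu, k1 m le_rfl] at hu2
  have hu3 := hmv (m + 1) le_rfl
  have e : ((t + 1 + (m + 1) : ℕ) : ZMod n) - v - v = u - v := by
    rw [hu2]; push_cast; ring
  rw [e] at hu3
  refine ⟨by omega, ?_⟩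
  rintro z hz ⟨hz1, hz2⟩
  obtain ⟨j, hj⟩ : ∃ j, (z - v).val = (w - v).val + (j + 1) := ⟨(z - v).val - (w - v).val - 1, by omega⟩
  have a := hmv (j + 1) (by omega)
  rw [← hj] at a
  have b := ZMod.val_injective n a
  have c := (act_T hn hD.1 (t + 1 + j) x).2 hx
  rw [k1 j (by omega)] at c
  have d := (jump_iff hn c (D := D)).2 (by
    left
    have : ((t + 1 + j : ℕ) : ZMod n) + 1 - v = z := by
      have := sub_left_injective b
      rw [← this]; push_cast; ring
    rw [this]; exact hz)
  have e' := k1 (j + 1) (by omega)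
  rw [← add_assoc, T_succ, k1 j (by omega)] at e'
  push_cast at e' d
  exact d e'

lemma edg_kind {nx : Equiv.Perm (ZMod n)} (hn : Adm nx) {D : Set (Sym2 (ZMod n))}
    (hD : Good nx D) {x : ZMod n} (hx : act nx 0 x) {u v : ZMod n}
    (h : Edg nx D x u v) : s(u, v) ∈ D ∨ nx u = v := by
  obtain ⟨t, h1, h2, h3⟩ := h
  have hj : T nx D (t + 1) x ≠ T nx D t x := by rw [h1, h2]; exact h3
  obtain ⟨hj, hu⟩ := T_jump hn hD hx hj
  rw [h1, h2] at hu
  rw [h2] at hj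
  have ha := (act_T hn hD.1 t x).2 hx
  rw [h2] at ha
  have hm := act_move hn ha
  rw [← hu] at hm
  unfold jmp at hj
  rw [← hu] at hj
  rcases hj with hj | hj | hj
  · left; rw [Sym2.eq_swap]; exact hj
  · have := ha.1
    rw [hj] at this
    omega
  · right; exact hj

lemma edg_exists {nx : Equiv.Perm (ZMod n)} (hn : Adm nx) {D : Set (Sym2 (ZMod n))}
    (hD : Good nx D) {u v : ZMod n} (h : s(u, v) ∈ D ∨ nx u = v) :
    ∃ x, act nx 0 x ∧ Edg nx D x u v := by
  have hb : (nx v - v).val < (u - v).val ∧ (u - v).val ≤ (nx.symm v - v).val := by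
    rcases h with h | h
    · have := (hD.1 _ _ h).2
      exact ⟨this.1, this.2.le⟩
    · have e : nx.symm v = u := by rw [← h]; simp
      have := hn.lt v
      rw [e] at this ⊢
      exact ⟨this, le_rfl⟩
  have hp := hn.pos v
  have hv : (u + v - 1 - v - v).val = (u - v).val - 1 := by
    have h1 := ZMod.val_lt (u - v)
    have h2 := vsucc (u + v - 1 - v - v)
    have e : u + v - 1 - v - v + 1 = u - v := by ring
    rw [e] at h2
    split_ifs at h2 <;> omega
  have hact : act nx (u + v - 1) v := by
    unfold act; rw [hv]; omega
  have et : (((u + v - 1).val : ℕ) : ZMod n) = u + v - 1 := by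
    rw [ZMod.natCast_val, ZMod.cast_id]
  have eT : T nx D (u + v - 1).val ((T nx D (u + v - 1).val).symm v) = v := by simp
  have ha0 : act nx 0 ((T nx D (u + v - 1).val).symm v) := by
    rw [← act_T hn hD.1 (u + v - 1).val, eT, et]; exact hact
  refine ⟨_, ha0, (u + v - 1).val, ?_, eT, ?_⟩
  · rw [T_succ, eT]; push_cast
    rw [et, sub_add_cancel, stp_of_jmp, add_sub_cancel_right]
    unfold jmp
    rw [add_sub_cancel_right, Sym2.eq_swap]
    tauto
  · intro h'
    rw [h'] at hb; simp at hb

lemma edg_inj {nx : Equiv.Perm (ZMod n)} (hn : Adm nx) {D : Set (Sym2 (ZMod n))}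
    (hD : Good nx D) {x y : ZMod n} (hx : act nx 0 x) (hy : act nx 0 y) {u v : ZMod n}
    (h : Edg nx D x u v) (h' : Edg nx D y u v) : x = y := by
  obtain ⟨t, h1, h2, h3⟩ := h
  obtain ⟨t', h1', h2', h3'⟩ := h'
  have a := (T_jump hn hD hx (by rw [h1, h2]; exact h3)).2
  have b := (T_jump hn hD hy (by rw [h1', h2']; exact h3')).2
  rw [h1, h2] at a
  rw [h1', h2'] at b
  have : (t' : ZMod n) = t := by
    have e1 : (t : ZMod n) = u + v - 1 := by rw [a]; ring
    have e2 : (t' : ZMod n) = u + v - 1 := by rw [b]; ring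
    rw [e1, e2]
  apply (T nx D t).injective
  rw [h2, T_congr hD hy this.symm, h2']

lemma edg_count {nx : Equiv.Perm (ZMod n)} (hn : Adm nx) {D : Set (Sym2 (ZMod n))}
    (hD : Good nx D) {x : ZMod n} (hx : act nx 0 x) {u v : ZMod n}
    (h : Edg nx D x u v) :
    (VS nx D x).card = 2 * (((VS nx D x).filter
      (fun z => 0 < (z - u).val ∧ (z - u).val < (v - u).val)).card + 1) + 1 := by
  have hmem := edg_mem h
  have hnp : 0 < n := NeZero.pos n
  choose! f hf using fun u (hu : u ∈ VS nx D x) => edg_out_exists hn hD hx hu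
  have hinj : Set.InjOn f (VS nx D x : Set (ZMod n)) := by
    intro a ha b hb hab
    apply edg_in_unique hn hD hx (hf a ha)
    rw [hab]; exact hf b hb
  have hvu : 0 < (v - u).val := by
    obtain ⟨_, _, _, h3⟩ := h
    exact (vpos _ _).2 h3.symm
  have hil : ∀ a ∈ VS nx D x,
      (0 < (a - u).val → (a - u).val ≤ (v - u).val → (v - u).val < (f a - u).val) ∧
      ((v - u).val < (a - u).val → (f a - u).val < (v - u).val) := by
    intro a ha
    obtain ⟨t, h1, h2, h3⟩ := h
    obtain ⟨t', h1', h2', h3'⟩ := hf a ha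
    have hj : T nx D (t + 1) x ≠ T nx D t x := by rw [h1, h2]; exact h3
    obtain ⟨s, hs, -, e1, e2⟩ := edg_reidx hD hx t t'
    have e0 : T nx D (t + 1 + (n - 1)) x = T nx D t x := by
      rw [show t + 1 + (n - 1) = t + n by omega, T_per hD hx]
    have := interlace hn (T_path hn hD hx hj) s hs (by
      show T nx D (t + 1 + (s + 1)) x ≠ T nx D (t + 1 + s) x
      rw [e1, e2, h1', h2']; exact h3')
    simp only [e1, e2, h1', h2', e0, h1, h2, add_zero] at this
    exact this
  set S := VS nx D x with hS
  set C := S.filter (fun z => 0 < (z - u).val ∧ (z - u).val < (v - u).val) with hC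
  set B := S.filter (fun z => (v - u).val < (z - u).val) with hB
  have c1 : (insert v C).card ≤ B.card := by
    apply Finset.card_le_card_of_injOn f
    · intro a ha
      rw [Finset.mem_coe, Finset.mem_insert] at ha
      have ha' : a ∈ S ∧ 0 < (a - u).val ∧ (a - u).val ≤ (v - u).val := by
        rcases ha with rfl | ha
        · exact ⟨hmem.2, hvu, le_rfl⟩
        · rw [hC, Finset.mem_filter] at ha
          exact ⟨ha.1, ha.2.1, ha.2.2.le⟩
      rw [Finset.mem_coe, hB, Finset.mem_filter]
      exact ⟨(edg_mem (hf a ha'.1)).2, (hil a ha'.1).1 ha'.2.1 ha'.2.2⟩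
    · intro a ha b hb hab
      apply hinj _ _ hab
      · simp only [Finset.coe_insert, Set.mem_insert_iff, Finset.mem_coe] at ha
        rcases ha with rfl | ha
        · exact hmem.2
        · exact (Finset.mem_filter.1 ha).1
      · simp only [Finset.coe_insert, Set.mem_insert_iff, Finset.mem_coe] at hb
        rcases hb with rfl | hb
        · exact hmem.2
        · exact (Finset.mem_filter.1 hb).1
  have c2 : B.card ≤ (insert u C).card := by
    apply Finset.card_le_card_of_injOn f
    · intro a ha
      rw [Finset.mem_coe, hB, Finset.mem_filter] at ha
      have h1 := (hil a ha.1).2 ha.2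
      rw [Finset.mem_coe, Finset.mem_insert, hC, Finset.mem_filter]
      by_cases h2 : f a = u
      · left; exact h2
      · right
        exact ⟨(edg_mem (hf a ha.1)).2, (vpos _ _).2 h2, h1⟩
    · intro a ha b hb hab
      exact hinj (Finset.mem_filter.1 ha).1 (Finset.mem_filter.1 hb).1 hab
  have hv : v ∉ C := by rw [hC, Finset.mem_filter]; omega
  have hu : u ∉ C := by rw [hC, Finset.mem_filter]; simp
  rw [Finset.card_insert_of_notMem hv] at c1
  rw [Finset.card_insert_of_notMem hu] at c2
  have hSe : S = insert u (insert v C) ∪ B := by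
    ext z
    simp only [Finset.mem_union, Finset.mem_insert, hC, hB, Finset.mem_filter]
    constructor
    · intro hz
      by_cases h1 : z = u
      · tauto
      by_cases h2 : z = v
      · tauto
      have h3 := (vpos z u).2 h1
      have h4 : (z - u).val ≠ (v - u).val := fun h =>
        h2 (sub_left_injective (ZMod.val_injective n h))
      rcases lt_or_gt_of_ne h4 with h4 | h4
      · left; right; right; exact ⟨hz, h3, h4⟩
      · right; exact ⟨hz, h4⟩
    · rintro ((rfl | rfl | hz) | hz)
      · exact hmem.1
      · exact hmem.2
      · exact hz.1
      · exact hz.1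
  have hdisj : Disjoint (insert u (insert v C)) B := by
    rw [Finset.disjoint_left]
    intro z hz hzB
    rw [hB, Finset.mem_filter] at hzB
    simp only [Finset.mem_insert, hC, Finset.mem_filter] at hz
    rcases hz with rfl | rfl | hz
    · simp at hzB
    · omega
    · omega
  have huv : u ∉ insert v C := by
    rw [Finset.mem_insert]
    rintro (h | h)
    · rw [h] at hvu; simp at hvu
    · exact hu h
  have hcard : S.card = C.card + 1 + 1 + B.card := by
    conv_lhs => rw [hSe]
    rw [Finset.card_union_of_disjoint hdisj, Finset.card_insert_of_notMem huv,
      Finset.card_insert_of_notMem hv]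
  omega

end SD

namespace SD

variable {n : ℕ} [NeZero n]

/-- A star of a star decomposition, in combinatorial form. -/
structure St (nx : Equiv.Perm (ZMod n)) (D : Set (Sym2 (ZMod n))) (S : Finset (ZMod n))
    (sn sp : ZMod n → ZMod n) (k : ℕ) : Prop where
  card : S.card = 2 * k + 1
  sn_mem : ∀ x ∈ S, sn x ∈ S
  sp_mem : ∀ x ∈ S, sp x ∈ S
  sn_sp : ∀ x ∈ S, sn (sp x) = x
  out : ∀ x ∈ S, (S.filter (fun z => 0 < (z - x).val ∧ (z - x).val < (sn x - x).val)).card + 1 = k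
  pos : ∀ x ∈ S, 0 < (sn x - x).val
  turn : ∀ x ∈ S, (sn x - x).val < (sp x - x).val
  kind : ∀ x ∈ S, s(x, sn x) ∈ D ∨ nx x = sn x
  nosplit : ∀ x ∈ S, ∀ z, s(x, z) ∈ D →
    ¬ ((sn x - x).val < (z - x).val ∧ (z - x).val < (sp x - x).val)

/-- `x` is active in the star at phase `t`. -/
def sact (S : Finset (ZMod n)) (sn sp : ZMod n → ZMod n) (t x : ZMod n) : Prop :=
  x ∈ S ∧ (sn x - x).val ≤ (t - x - x).val ∧ (t - x - x).val < (sp x - x).val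

lemma vdiff (w y x : ZMod n) :
    (w - y).val = if (y - x).val ≤ (w - x).val then (w - x).val - (y - x).val
      else (w - x).val + n - (y - x).val := by
  rw [← vsub]; congr 1; ring

lemma star_counts {nx : Equiv.Perm (ZMod n)} {D : Set (Sym2 (ZMod n))} {S : Finset (ZMod n)}
    {sn sp : ZMod n → ZMod n} {k : ℕ} (h : St nx D S sn sp k) {t x : ZMod n}
    (ha : sact S sn sp t x) :
    (S.filter (fun w => 0 < (w - x).val ∧ (w - x).val ≤ (t - x - x).val)).card = k ∧
    (S.filter (fun w => (t - x - x).val < (w - x).val)).card = k := by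
  obtain ⟨hx, h1, h2⟩ := ha
  have c1 : k ≤ (S.filter (fun w => 0 < (w - x).val ∧ (w - x).val ≤ (t - x - x).val)).card := by
    have e := h.out x hx
    have hn : sn x ∉ S.filter (fun z => 0 < (z - x).val ∧ (z - x).val < (sn x - x).val) := by
      rw [Finset.mem_filter]; omega
    rw [← Finset.card_insert_of_notMem hn] at e
    rw [← e]
    apply Finset.card_le_card
    intro w hw
    rw [Finset.mem_insert, Finset.mem_filter] at hw
    rw [Finset.mem_filter]
    rcases hw with rfl | hw
    · exact ⟨h.sn_mem x hx, h.pos x hx, h1⟩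
    · exact ⟨hw.1, hw.2.1, by omega⟩
  have c2 : k ≤ (S.filter (fun w => (t - x - x).val < (w - x).val)).card := by
    have hy := h.sp_mem x hx
    have e := h.out _ hy
    rw [h.sn_sp x hx] at e
    have hn : sp x ∉ S.filter
        (fun z => 0 < (z - sp x).val ∧ (z - sp x).val < (x - sp x).val) := by
      rw [Finset.mem_filter]; simp
    rw [← Finset.card_insert_of_notMem hn] at e
    rw [← e]
    apply Finset.card_le_card
    intro w hw
    rw [Finset.mem_insert, Finset.mem_filter] at hw
    rw [Finset.mem_filter]
    rcases hw with rfl | hw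
    · exact ⟨hy, h2⟩
    · refine ⟨hw.1, ?_⟩
      have a := vdiff w x (sp x)
      have b := vneg x (sp x) (by
        intro h'
        rw [← h'] at h2; simp at h2)
      have c := ZMod.val_lt (w - sp x)
      have d := ZMod.val_lt (x - sp x)
      split_ifs at a <;> omega
  have c3 : (S.filter (fun w => 0 < (w - x).val ∧ (w - x).val ≤ (t - x - x).val)).card +
      (S.filter (fun w => (t - x - x).val < (w - x).val)).card + 1 ≤ S.card := by
    have hd : Disjoint (S.filter (fun w => 0 < (w - x).val ∧ (w - x).val ≤ (t - x - x).val))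
        (S.filter (fun w => (t - x - x).val < (w - x).val)) := by
      rw [Finset.disjoint_left]
      intro w h1 h2
      rw [Finset.mem_filter] at h1 h2
      omega
    rw [← Finset.card_union_of_disjoint hd, ← Finset.card_insert_of_notMem (a := x)]
    · apply Finset.card_le_card
      intro w hw
      simp only [Finset.mem_insert, Finset.mem_union, Finset.mem_filter] at hw
      rcases hw with rfl | hw | hw
      · exact hx
      · exact hw.1
      · exact hw.1
    · simp
  have := h.card
  omega

lemma star_unique {nx : Equiv.Perm (ZMod n)} {D : Set (Sym2 (ZMod n))} {S : Finset (ZMod n)}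
    {sn sp : ZMod n → ZMod n} {k : ℕ} (h : St nx D S sn sp k) {t x y : ZMod n}
    (ha : sact S sn sp t x) (hb : sact S sn sp t y) : y = x := by
  by_contra hne
  obtain ⟨i1, i2⟩ := star_counts h ha
  obtain ⟨j1, j2⟩ := star_counts h hb
  have hj := (vpos y x).2 hne
  have hjn := ZMod.val_lt (y - x)
  have hdn := ZMod.val_lt (t - x - x)
  have hdy : (t - y - y).val = if 2 * (y - x).val ≤ (t - x - x).val then
      (t - x - x).val - 2 * (y - x).val else if 2 * (y - x).val ≤ (t - x - x).val + n then
      (t - x - x).val + n - 2 * (y - x).val else (t - x - x).val + 2 * n - 2 * (y - x).val := by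
    have e : t - y - y = (t - x - x - (y - x)) - (y - x) := by ring
    have q1 := vsub (t - x - x - (y - x)) (y - x)
    have q2 := vsub (t - x - x) (y - x)
    rw [e]
    split_ifs at q1 q2 ⊢ <;> omega
  have hw := fun w => vdiff w y x
  have hwn := fun w => ZMod.val_lt (w - x)
  have hwy : ∀ w : ZMod n, w = y → (w - x).val = (y - x).val := fun w h => by rw [h]
  have hy := hb.1
  have fin : ∀ A B : Finset (ZMod n), A.card = k → B.card = k → y ∈ B →
      (∀ w ∈ A, w ≠ y ∧ w ∈ B) → False := by
    intro A B hA hB hyB hAB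
    have h1 : A ⊆ B.erase y := fun w hw => Finset.mem_erase.2 (hAB w hw)
    have h2 := Finset.card_le_card h1
    rw [Finset.card_erase_of_mem hyB] at h2
    have := Finset.card_pos.2 ⟨y, hyB⟩
    omega
  by_cases a1 : (y - x).val ≤ (t - x - x).val
  · have hyI : y ∈ S.filter (fun w => 0 < (w - x).val ∧ (w - x).val ≤ (t - x - x).val) :=
      Finset.mem_filter.2 ⟨hy, hj, a1⟩
    by_cases a2 : 2 * (y - x).val ≤ (t - x - x).val
    · rw [if_pos a2] at hdy
      refine fin _ _ j1 i1 hyI ?_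
      intro w hw'
      rw [Finset.mem_filter] at hw' ⊢
      have b1 := hw w
      have b2 := hwn w
      have b3 := hwy w
      refine ⟨fun h => ?_, hw'.1, ?_⟩
      · have := b3 h; split_ifs at b1 <;> omega
      · split_ifs at b1 <;> omega
    · rw [if_neg a2, if_pos (by omega)] at hdy
      refine fin _ _ j2 i1 hyI ?_
      intro w hw'
      rw [Finset.mem_filter] at hw' ⊢
      have b1 := hw w
      have b2 := hwn w
      have b3 := hwy w
      refine ⟨fun h => ?_, hw'.1, ?_⟩
      · have := b3 h; split_ifs at b1 <;> omega
      · split_ifs at b1 <;> omega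
  · have hyJ : y ∈ S.filter (fun w => (t - x - x).val < (w - x).val) :=
      Finset.mem_filter.2 ⟨hy, by omega⟩
    rw [if_neg (by omega)] at hdy
    by_cases a2 : 2 * (y - x).val ≤ (t - x - x).val + n
    · rw [if_pos a2] at hdy
      refine fin _ _ j1 i2 hyJ ?_
      intro w hw'
      rw [Finset.mem_filter] at hw' ⊢
      have b1 := hw w
      have b2 := hwn w
      have b3 := hwy w
      refine ⟨fun h => ?_, hw'.1, ?_⟩
      · have := b3 h; split_ifs at b1 <;> omega
      · split_ifs at b1 <;> omega
    · rw [if_neg a2] at hdy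
      refine fin _ _ j2 i2 hyJ ?_
      intro w hw'
      rw [Finset.mem_filter] at hw' ⊢
      have b1 := hw w
      have b2 := hwn w
      have b3 := hwy w
      refine ⟨fun h => ?_, hw'.1, ?_⟩
      · have := b3 h; split_ifs at b1 <;> omega
      · split_ifs at b1 <;> omega

lemma val_inj' {a b x : ZMod n} (h : (a - x).val = (b - x).val) : a = b :=
  sub_left_injective (ZMod.val_injective n h)

lemma sact_step {nx : Equiv.Perm (ZMod n)} (hn : Adm nx) {D : Set (Sym2 (ZMod n))}
    (hD : IsDiag nx D) {S : Finset (ZMod n)}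
    {sn sp : ZMod n → ZMod n} {k : ℕ} (h : St nx D S sn sp k) {t x : ZMod n}
    (ha : sact S sn sp t x) : sact S sn sp (t + 1) (stp nx D (t + 1) x) := by
  obtain ⟨hx, h1, h2⟩ := ha
  have hb := ZMod.val_lt (sp x - x)
  have hde : (t + 1 - x - x).val = (t - x - x).val + 1 := by
    rw [show t + 1 - x - x = (t - x - x) + 1 by ring, vsucc, if_neg (by omega)]
  have hspk : s(x, sp x) ∈ D ∨ nx (sp x) = x := by
    have := h.kind _ (h.sp_mem x hx)
    rw [h.sn_sp x hx] at this
    rwa [Sym2.eq_swap]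
  by_cases hj : jmp nx D (t + 1) x
  · have hy : t + 1 - x = sp x := by
      unfold jmp at hj
      generalize t + 1 - x = y at hj hde
      rcases hj with hj | hj | hj
      · have := h.nosplit x hx y hj
        apply val_inj' (x := x); omega
      · rcases h.kind x hx with h3 | h3
        · have := (hD _ _ h3).1.1
          rw [hj] at this; omega
        · rw [h3] at hj; rw [hj] at h1; omega
      · have hs : nx.symm x = y := by rw [← hj]; simp
        rcases hspk with h3 | h3
        · have := (hD _ _ h3).1.2
          rw [hs] at this; omega
        · exact nx.injective (hj.trans h3.symm)
    rw [stp_of_jmp hj, hy]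
    have hm := h.sp_mem x hx
    have ht := h.turn _ hm
    rw [h.sn_sp x hx] at ht
    have e : t + 1 - sp x - sp x = x - sp x := by rw [← hy]; ring
    refine ⟨hm, ?_, ?_⟩
    · rw [h.sn_sp x hx, e]
    · rw [e]; exact ht
  · rw [stp_of_not hj]
    refine ⟨hx, by omega, ?_⟩
    have : (t - x - x).val + 1 ≠ (sp x - x).val := by
      intro h3
      rw [← hde] at h3
      have h4 := val_inj' h3
      apply hj
      unfold jmp
      rw [h4]
      tauto
    omega

lemma good_of_stars {nx : Equiv.Perm (ZMod n)} (hn : Adm nx) {D : Set (Sym2 (ZMod n))}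
    (hD : IsDiag nx D)
    (h : ∀ u v, (s(u, v) ∈ D ∨ nx u = v) → ∃ S sn sp k, St nx D S sn sp k ∧ v ∈ S ∧ sp v = u) :
    Good nx D := by
  refine ⟨hD, ?_⟩
  intro x hx
  let Q : ℕ → Prop := fun m => ∃ z, (z - x).val = m ∧ (0 - x - x).val < (z - x).val ∧
    (s(z, x) ∈ D ∨ nx z = x)
  have hQ : ∃ m, Q m := ⟨_, nx.symm x, rfl, hx.2, by simp⟩
  obtain ⟨z, hz1, hz2, hz3⟩ := Nat.find_spec hQ
  obtain ⟨S, sn, sp, k, hS, hxS, hsp⟩ := h z x hz3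
  have hs0 : sact S sn sp 0 x := by
    refine ⟨hxS, ?_, by rw [hsp]; exact hz2⟩
    rcases hS.kind x hxS with h1 | h1
    · by_contra h2
      push Not at h2
      have h3 := hS.turn x hxS
      rw [hsp, hz1] at h3
      exact Nat.find_min hQ h3 ⟨_, rfl, h2, Or.inl (by rwa [Sym2.eq_swap])⟩
    · rw [← h1]; exact hx.1
  have hsk : ∀ j : ℕ, sact S sn sp (j : ZMod n) (T nx D j x) := by
    intro j
    induction j with
    | zero => simpa [T] using hs0
    | succ j ih =>
      rw [T_succ]; push_cast
      exact sact_step hn hD hS ih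
  have := hsk n
  rw [ZMod.natCast_self] at this
  exact star_unique hS hs0 this

end SD

namespace SD

variable {n : ℕ} [NeZero n]

lemma exp_inj_Ioc {a b : ℝ} (ha : 0 < a) (ha' : a ≤ 2 * Real.pi) (hb : 0 < b)
    (hb' : b ≤ 2 * Real.pi) (h : Complex.exp (a * I) = Complex.exp (b * I)) : a = b := by
  obtain ⟨k, hk⟩ := Complex.exp_eq_exp_iff_exists_int.1 h
  have h1 : ((a : ℂ)) = ((b + k * (2 * Real.pi) : ℝ) : ℂ) := by
    push_cast
    apply mul_right_cancel₀ I_ne_zero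
    rw [hk]; ring
  have h2 : a = b + k * (2 * Real.pi) := by exact_mod_cast h1
  have hpi := Real.pi_pos
  have h3 : k = 0 := by
    have h4 : (k : ℝ) < 1 := by nlinarith
    have h5 : (-1 : ℝ) < k := by nlinarith
    have h4' : k < 1 := by exact_mod_cast h4
    have h5' : -1 < k := by exact_mod_cast h5
    omega
  rw [h2, h3]; simp

lemma posArc_pos (u v : ℂ) : 0 < posArc u v := by
  unfold posArc
  have := neg_pi_lt_arg (v / u)
  have := Real.pi_pos
  split_ifs <;> linarith

lemma posArc_le (u v : ℂ) : posArc u v ≤ 2 * Real.pi := by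
  unfold posArc
  have := arg_le_pi (v / u)
  have := Real.pi_pos
  split_ifs <;> linarith

lemma exp_posArc {u v : ℂ} (hu : ‖u‖ = 1) (hv : ‖v‖ = 1) :
    Complex.exp (posArc u v * I) = v / u := by
  have h1 : Complex.exp (arg (v / u) * I) = v / u := by
    have := norm_mul_exp_arg_mul_I (v / u)
    rw [norm_div, hu, hv] at this
    simpa using this
  unfold posArc
  split_ifs
  · exact h1
  · push_cast
    rw [add_mul, Complex.exp_add, Complex.exp_two_pi_mul_I, mul_one, h1]

lemma posArc_lt {u v : ℂ} (hu : ‖u‖ = 1) (hv : ‖v‖ = 1) (h : v ≠ u) :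
    posArc u v < 2 * Real.pi := by
  apply lt_of_le_of_ne (posArc_le u v)
  intro h1
  have h2 := exp_posArc hu hv
  rw [h1] at h2
  push_cast at h2
  rw [Complex.exp_two_pi_mul_I] at h2
  have : u ≠ 0 := by intro h'; rw [h'] at hu; simp at hu
  rw [eq_div_iff this, one_mul] at h2
  exact h h2.symm

lemma posArc_eq {u v : ℂ} (hu : ‖u‖ = 1) (hv : ‖v‖ = 1) :
    posArc u v = if arg u < arg v then arg v - arg u else arg v - arg u + 2 * Real.pi := by
  have eu := norm_mul_exp_arg_mul_I u
  have ev := norm_mul_exp_arg_mul_I v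
  rw [hu] at eu
  rw [hv] at ev
  simp only [ofReal_one, one_mul] at eu ev
  have a1 := neg_pi_lt_arg u
  have a2 := arg_le_pi u
  have b1 := neg_pi_lt_arg v
  have b2 := arg_le_pi v
  have hd : Complex.exp ((arg v - arg u) * I) = v / u := by
    rw [sub_mul, Complex.exp_sub, eu, ev]
  split_ifs with h
  · apply exp_inj_Ioc (posArc_pos _ _) (posArc_le _ _) (by linarith) (by linarith)
    rw [exp_posArc hu hv]; push_cast; rw [hd]
  · apply exp_inj_Ioc (posArc_pos _ _) (posArc_le _ _) (by linarith) (by linarith)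
    rw [exp_posArc hu hv]; push_cast
    rw [add_mul, Complex.exp_add, Complex.exp_two_pi_mul_I, mul_one, hd]

lemma exp_sub_one (A : ℝ) : Complex.exp (A * I) - 1 =
    2 * I * (Real.sin (A / 2) : ℝ) * Complex.exp ((A / 2 : ℝ) * I) := by
  have h1 : Complex.exp (A * I) = Complex.exp ((A / 2 : ℝ) * I) * Complex.exp ((A / 2 : ℝ) * I) := by
    rw [← Complex.exp_add]; congr 1; push_cast; ring
  have h2 : (1 : ℂ) = Complex.exp (-((A / 2 : ℝ) * I)) * Complex.exp ((A / 2 : ℝ) * I) := by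
    rw [← Complex.exp_add]; simp
  have h3 : 2 * I * ((Real.sin (A / 2) : ℝ) : ℂ) =
      Complex.exp ((A / 2 : ℝ) * I) - Complex.exp (-((A / 2 : ℝ) * I)) := by
    rw [ofReal_sin, Complex.sin]
    rw [neg_mul]
    linear_combination (Complex.exp (-((A / 2 : ℝ) * I)) - Complex.exp ((A / 2 : ℝ) * I)) * I_sq
  rw [h3, sub_mul, ← h1, ← h2]

lemma vangle_eq {x v z : ℂ} (hx : ‖x‖ = 1) (hv : ‖v‖ = 1) (hz : ‖z‖ = 1) (hxv : x ≠ v)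
    (hzv : z ≠ v) : vangle x v z = |posArc v x - posArc v z| / 2 := by
  have hv0 : v ≠ 0 := by intro h'; rw [h'] at hv; simp at hv
  have ex : x - v = v * (Complex.exp (posArc v x * I) - 1) := by
    rw [exp_posArc hv hx]; field_simp
  have ez : z - v = v * (Complex.exp (posArc v z * I) - 1) := by
    rw [exp_posArc hv hz]; field_simp
  have a1 := posArc_pos v x
  have a2 := posArc_lt hv hx hxv
  have b1 := posArc_pos v z
  have b2 := posArc_lt hv hz hzv
  have s1 : 0 < Real.sin (posArc v x / 2) :=
    Real.sin_pos_of_pos_of_lt_pi (by linarith) (by linarith)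
  have s2 : 0 < Real.sin (posArc v z / 2) :=
    Real.sin_pos_of_pos_of_lt_pi (by linarith) (by linarith)
  have e : (x - v) / (z - v) = ((Real.sin (posArc v x / 2) / Real.sin (posArc v z / 2) : ℝ) : ℂ) *
      Complex.exp (((posArc v x - posArc v z) / 2 : ℝ) * I) := by
    rw [ex, ez, exp_sub_one, exp_sub_one]
    have e1 : Complex.exp (((posArc v x - posArc v z) / 2 : ℝ) * I) =
        Complex.exp ((posArc v x / 2 : ℝ) * I) / Complex.exp ((posArc v z / 2 : ℝ) * I) := by
      rw [← Complex.exp_sub]; congr 1; push_cast; ring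
    rw [e1]
    have s2' : ((Real.sin (posArc v z / 2) : ℝ) : ℂ) ≠ 0 := by exact_mod_cast s2.ne'
    have hI := I_ne_zero
    have hE := Complex.exp_ne_zero ((posArc v z / 2 : ℝ) * I)
    rw [ofReal_div (Real.sin (posArc v x / 2))]
    generalize ((Real.sin (posArc v z / 2) : ℝ) : ℂ) = q at *
    generalize ((Real.sin (posArc v x / 2) : ℝ) : ℂ) = q' at *
    generalize Complex.exp ((posArc v z / 2 : ℝ) * I) = q1 at *
    field_simp
  unfold vangle
  rw [e, Complex.arg_real_mul _ (by positivity), Complex.arg_exp_mul_I,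
    (toIocMod_eq_self Real.two_pi_pos).2 ⟨by linarith, by linarith⟩, abs_div]
  norm_num

lemma vangle_left (v z : ℂ) : vangle v v z = 0 := by simp [vangle]

lemma vangle_right (v z : ℂ) : vangle z v v = 0 := by simp [vangle]

lemma splits_iff {u v w x : ℂ} (hu : ‖u‖ = 1) (hv : ‖v‖ = 1) (hw : ‖w‖ = 1) (hx : ‖x‖ = 1)
    (huv : u ≠ v) (hwv : w ≠ v) (h : posArc v w < posArc v u) :
    (0 < vangle u v x ∧ 0 < vangle x v w ∧ vangle u v x + vangle x v w = vangle u v w) ↔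
      x ≠ v ∧ posArc v w < posArc v x ∧ posArc v x < posArc v u := by
  by_cases hxv : x = v
  · subst hxv
    simp [vangle_right]
  · rw [vangle_eq hu hv hx huv hxv, vangle_eq hx hv hw hxv hwv, vangle_eq hu hv hw huv hwv]
    rw [abs_of_pos (show 0 < posArc v u - posArc v w by linarith)]
    constructor
    · rintro ⟨h1, h2, h3⟩
      refine ⟨hxv, ?_, ?_⟩
      · rcases abs_cases (posArc v u - posArc v x) with ⟨a, _⟩ | ⟨a, _⟩ <;>
        rcases abs_cases (posArc v x - posArc v w) with ⟨b, _⟩ | ⟨b, _⟩ <;> linarith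
      · rcases abs_cases (posArc v u - posArc v x) with ⟨a, _⟩ | ⟨a, _⟩ <;>
        rcases abs_cases (posArc v x - posArc v w) with ⟨b, _⟩ | ⟨b, _⟩ <;> linarith
    · rintro ⟨-, h1, h2⟩
      rw [abs_of_pos (show 0 < posArc v u - posArc v x by linarith),
        abs_of_pos (show 0 < posArc v x - posArc v w by linarith)]
      refine ⟨by linarith, by linarith, by linarith⟩

/-- An anticlockwise enumeration of a finite set of points on the circle. -/
structure Enum (V : Finset ℂ) (p : ZMod n → ℂ) : Prop where
  inj : Function.Injective p
  rng : ∀ z, z ∈ V ↔ ∃ x, p x = z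
  nrm : ∀ x, ‖p x‖ = 1
  key : ∀ x y z, y ≠ x → z ≠ x →
    (posArc (p x) (p y) < posArc (p x) (p z) ↔ (y - x).val < (z - x).val)

lemma exists_enum (V : Finset ℂ) (hV : ∀ v ∈ V, ‖v‖ = 1) (hn : V.card = n) :
    ∃ p : ZMod n → ℂ, Enum V p := by
  have hrec : ∀ v ∈ V, Complex.exp (arg v * I) = v := by
    intro v hv
    have := norm_mul_exp_arg_mul_I v
    rw [hV v hv] at this
    simpa using this
  have hcard : (V.image arg).card = n := by
    rw [Finset.card_image_of_injOn, hn]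
    intro a ha b hb hab
    rw [← hrec a ha, ← hrec b hb]
    have hab' : arg a = arg b := hab
    rw [hab']
  let e := (V.image arg).orderIsoOfFin hcard
  let a : ZMod n → ℝ := fun x => (e ⟨x.val, ZMod.val_lt x⟩ : ℝ)
  have hae : ∀ x, ∃ v ∈ V, arg v = a x := fun x =>
    Finset.mem_image.1 (e ⟨x.val, ZMod.val_lt x⟩).2
  choose p hp1 hp2 using hae
  have hlt : ∀ x y, arg (p x) < arg (p y) ↔ x.val < y.val := by
    intro x y
    rw [hp2, hp2]
    show ((e ⟨x.val, ZMod.val_lt x⟩ : ℝ) < (e ⟨y.val, ZMod.val_lt y⟩ : ℝ)) ↔ _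
    rw [Subtype.coe_lt_coe, OrderIso.lt_iff_lt, Fin.mk_lt_mk]
  refine ⟨p, ?_, ?_, fun x => hV _ (hp1 x), ?_⟩
  · intro x y hxy
    have h1 := hlt x y
    have h2 := hlt y x
    rw [hxy] at h1 h2
    apply ZMod.val_injective n
    simp only [lt_self_iff_false, false_iff] at h1 h2
    omega
  · intro z
    constructor
    · intro hz
      obtain ⟨i, hi⟩ := e.surjective ⟨arg z, Finset.mem_image_of_mem _ hz⟩
      refine ⟨((i : ℕ) : ZMod n), ?_⟩
      have hv : (((i : ℕ) : ZMod n)).val = i := by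
        rw [ZMod.val_natCast, Nat.mod_eq_of_lt i.2]
      rw [← hrec z hz, ← hrec _ (hp1 _), hp2]
      have : a ((i : ℕ) : ZMod n) = arg z := by
        show ((e ⟨(((i : ℕ) : ZMod n)).val, ZMod.val_lt _⟩ : ℝ)) = arg z
        have : (⟨(((i : ℕ) : ZMod n)).val, ZMod.val_lt _⟩ : Fin n) = i := Fin.ext hv
        rw [this, hi]
      rw [this]
    · rintro ⟨x, rfl⟩
      exact hp1 x
  · intro x y z hy hz
    rw [posArc_eq (hV _ (hp1 x)) (hV _ (hp1 y)), posArc_eq (hV _ (hp1 x)) (hV _ (hp1 z))]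
    have hyv : x.val ≠ y.val := fun h => hy (ZMod.val_injective n h).symm
    have hzv : x.val ≠ z.val := fun h => hz (ZMod.val_injective n h).symm
    have l1 := hlt x y
    have l2 := hlt x z
    have l3 := hlt y z
    have r1 := vsub y x
    have r2 := vsub z x
    have hx' := ZMod.val_lt x
    have hy' := ZMod.val_lt y
    have hz' := ZMod.val_lt z
    have a1 := neg_pi_lt_arg (p y)
    have a2 := arg_le_pi (p y)
    have b1 := neg_pi_lt_arg (p z)
    have b2 := arg_le_pi (p z)
    by_cases c1 : arg (p x) < arg (p y)
    · rw [if_pos c1]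
      have d1 := l1.1 c1
      rw [if_pos (by omega)] at r1
      by_cases c2 : arg (p x) < arg (p z)
      · rw [if_pos c2]
        have d2 := l2.1 c2
        rw [if_pos (by omega)] at r2
        rw [r1, r2, sub_lt_sub_iff_right, l3]
        omega
      · rw [if_neg c2]
        have d2 := mt l2.2 c2
        rw [if_neg (by omega)] at r2
        rw [r1, r2]
        constructor
        · intro _; omega
        · intro _; linarith
    · rw [if_neg c1]
      have d1 := mt l1.2 c1
      rw [if_neg (by omega)] at r1
      by_cases c2 : arg (p x) < arg (p z)
      · rw [if_pos c2]
        have d2 := l2.1 c2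
        rw [if_pos (by omega)] at r2
        rw [r1, r2]
        constructor
        · intro _; exfalso; linarith
        · intro _; exfalso; omega
      · rw [if_neg c2]
        have d2 := mt l2.2 c2
        rw [if_neg (by omega)] at r2
        rw [r1, r2, add_lt_add_iff_right, sub_lt_sub_iff_right, l3]
        omega

end SD

namespace SD

variable {n : ℕ} [NeZero n]

lemma next_edge (S : CyclicPolygon) {v : ℂ} (hv : v ∈ S.V) : (v, S.next v) ∈ S.E := by
  have h : ∃ w, (v, w) ∈ S.E := (S.outdeg v hv).exists
  unfold CyclicPolygon.next
  rw [dif_pos h]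
  exact h.choose_spec

lemma prev_edge (S : CyclicPolygon) {v : ℂ} (hv : v ∈ S.V) : (S.prev v, v) ∈ S.E := by
  have h : ∃ u, (u, v) ∈ S.E := (S.indeg v hv).exists
  unfold CyclicPolygon.prev
  rw [dif_pos h]
  exact h.choose_spec

lemma next_eq (S : CyclicPolygon) {v w : ℂ} (h : (v, w) ∈ S.E) : S.next v = w :=
  (S.outdeg v (S.endmem _ h).1).unique (next_edge S (S.endmem _ h).1) h

lemma prev_eq (S : CyclicPolygon) {u v : ℂ} (h : (u, v) ∈ S.E) : S.prev v = u :=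
  (S.indeg v (S.endmem _ h).2).unique (prev_edge S (S.endmem _ h).2) h

/-- inverse of the enumeration -/
def qq (p : ZMod n → ℂ) : ℂ → ZMod n := Function.invFun p

lemma qq_p {V : Finset ℂ} {p : ZMod n → ℂ} (hp : Enum V p) (x : ZMod n) : qq p (p x) = x :=
  Function.leftInverse_invFun hp.inj x

lemma p_qq {V : Finset ℂ} {p : ZMod n → ℂ} (hp : Enum V p) {z : ℂ} (hz : z ∈ V) :
    p (qq p z) = z := Function.invFun_eq ((hp.rng z).1 hz)

lemma acw_iff {V : Finset ℂ} {p : ZMod n → ℂ} (hp : Enum V p) (u v w : ZMod n) :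
    ACW (p u) (p v) (p w) ↔ u ≠ v ∧ v ≠ w ∧ u ≠ w ∧ (w - v).val < (u - v).val := by
  unfold ACW
  rw [hp.inj.ne_iff, hp.inj.ne_iff, hp.inj.ne_iff]
  apply and_congr_right; intro h1
  apply and_congr_right; intro h2
  apply and_congr_right; intro h3
  rw [hp.key u v w h1.symm h3.symm]
  have a := vdiff w v u
  have b := vneg u v h1
  have c := ZMod.val_lt (w - u)
  have d := ZMod.val_lt (v - u)
  have e : (w - u).val ≠ (v - u).val := fun h => h2 (val_inj' h).symm
  split_ifs at a <;> omega

/-- combinatorial next -/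
def cn (S : CyclicPolygon) (p : ZMod n → ℂ) (x : ZMod n) : ZMod n := qq p (S.next (p x))

def cp (S : CyclicPolygon) (p : ZMod n → ℂ) (x : ZMod n) : ZMod n := qq p (S.prev (p x))

lemma p_cn {V : Finset ℂ} {p : ZMod n → ℂ} (hp : Enum V p) {S : CyclicPolygon} (hS : S.V ⊆ V)
    {x : ZMod n} (hx : p x ∈ S.V) : p (cn S p x) = S.next (p x) :=
  p_qq hp (hS (S.endmem _ (next_edge S hx)).2)

lemma p_cp {V : Finset ℂ} {p : ZMod n → ℂ} (hp : Enum V p) {S : CyclicPolygon} (hS : S.V ⊆ V)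
    {x : ZMod n} (hx : p x ∈ S.V) : p (cp S p x) = S.prev (p x) :=
  p_qq hp (hS (S.endmem _ (prev_edge S hx)).1)

lemma cn_edge {V : Finset ℂ} {p : ZMod n → ℂ} (hp : Enum V p) {S : CyclicPolygon} (hS : S.V ⊆ V)
    {x : ZMod n} (hx : p x ∈ S.V) : (p x, p (cn S p x)) ∈ S.E := by
  rw [p_cn hp hS hx]; exact next_edge S hx

lemma cp_edge {V : Finset ℂ} {p : ZMod n → ℂ} (hp : Enum V p) {S : CyclicPolygon} (hS : S.V ⊆ V)
    {x : ZMod n} (hx : p x ∈ S.V) : (p (cp S p x), p x) ∈ S.E := by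
  rw [p_cp hp hS hx]; exact prev_edge S hx

lemma cn_eq {V : Finset ℂ} {p : ZMod n → ℂ} (hp : Enum V p) {S : CyclicPolygon}
    {x y : ZMod n} (h : (p x, p y) ∈ S.E) : cn S p x = y := by
  unfold cn; rw [next_eq S h, qq_p hp]

lemma cp_eq {V : Finset ℂ} {p : ZMod n → ℂ} (hp : Enum V p) {S : CyclicPolygon}
    {x y : ZMod n} (h : (p x, p y) ∈ S.E) : cp S p y = x := by
  unfold cp; rw [prev_eq S h, qq_p hp]

lemma c_turn {V : Finset ℂ} {p : ZMod n → ℂ} (hp : Enum V p) {S : CyclicPolygon} (hS : S.V ⊆ V)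
    {x : ZMod n} (hx : p x ∈ S.V) : cp S p x ≠ x ∧ cn S p x ≠ x ∧
      (cn S p x - x).val < (cp S p x - x).val := by
  have := (acw_iff hp _ _ _).1 (S.acw _ _ _ (cp_edge hp hS hx) (cn_edge hp hS hx))
  exact ⟨this.1, this.2.1.symm, this.2.2.2⟩

/-- the permutation of a cyclic polygon -/
def nxP {P : CyclicPolygon} {p : ZMod n → ℂ} (hp : Enum P.V p) : Equiv.Perm (ZMod n) where
  toFun := cn P p
  invFun := cp P p
  left_inv x := cp_eq hp (cn_edge hp subset_rfl ((hp.rng _).2 ⟨x, rfl⟩))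
  right_inv x := cn_eq hp (cp_edge hp subset_rfl ((hp.rng _).2 ⟨x, rfl⟩))

lemma nxP_apply {P : CyclicPolygon} {p : ZMod n → ℂ} (hp : Enum P.V p) (x : ZMod n) :
    nxP hp x = cn P p x := rfl

lemma nxP_symm {P : CyclicPolygon} {p : ZMod n → ℂ} (hp : Enum P.V p) (x : ZMod n) :
    (nxP hp).symm x = cp P p x := rfl

lemma p_mem {P : CyclicPolygon} {p : ZMod n → ℂ} (hp : Enum P.V p) (x : ZMod n) : p x ∈ P.V :=
  (hp.rng _).2 ⟨x, rfl⟩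

lemma nxP_adm {P : CyclicPolygon} {p : ZMod n → ℂ} (hp : Enum P.V p) : Adm (nxP hp) := by
  constructor
  · intro x
    exact (vpos _ _).2 (c_turn hp subset_rfl (p_mem hp x)).2.1
  · intro x
    exact (c_turn hp subset_rfl (p_mem hp x)).2.2

lemma nxP_edge {P : CyclicPolygon} {p : ZMod n → ℂ} (hp : Enum P.V p) (x y : ZMod n) :
    (p x, p y) ∈ P.E ↔ nxP hp x = y := by
  constructor
  · intro h; exact cn_eq hp h
  · rintro rfl
    exact cn_edge hp subset_rfl (p_mem hp x)

lemma splits_idx {V : Finset ℂ} {p : ZMod n → ℂ} (hp : Enum V p) {u v w x : ZMod n}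
    (h1 : u ≠ v) (h2 : w ≠ v) (h3 : (w - v).val < (u - v).val) :
    SplitsAngle3 (p u) (p v) (p w) (p x) ↔
      (w - v).val < (x - v).val ∧ (x - v).val < (u - v).val := by
  unfold SplitsAngle3
  rw [splits_iff (hp.nrm _) (hp.nrm _) (hp.nrm _) (hp.nrm _) (hp.inj.ne h1) (hp.inj.ne h2)
    ((hp.key v w u h2 h1).2 h3), hp.inj.ne_iff]
  constructor
  · rintro ⟨a, b, c⟩
    exact ⟨(hp.key _ _ _ h2 a).1 b, (hp.key _ _ _ a h1).1 c⟩
  · rintro ⟨b, c⟩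
    have a : x ≠ v := (vpos _ _).1 (by omega)
    exact ⟨a, (hp.key _ _ _ h2 a).2 b, (hp.key _ _ _ a h1).2 c⟩

lemma linkable_iff {P : CyclicPolygon} {p : ZMod n → ℂ} (hp : Enum P.V p) (x y : ZMod n) :
    Linkable P (p x) (p y) ↔ link (nxP hp) x y := by
  have key : ∀ x y, SplitsVertexAngle P (p x) (p y) ↔ link1 (nxP hp) x y := by
    intro x y
    have ht := c_turn hp subset_rfl (p_mem hp x)
    have := splits_idx hp (x := y) ht.1 ht.2.1 ht.2.2
    unfold SplitsAngle3 at this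
    rw [p_cn hp subset_rfl (p_mem hp x), p_cp hp subset_rfl (p_mem hp x)] at this
    unfold SplitsVertexAngle link1
    rw [nxP_apply, nxP_symm, ← this]
    simp [p_mem hp x]
  unfold Linkable LinkablePair link
  rw [key, key]
  constructor
  · exact fun h => h.2
  · intro h
    refine ⟨hp.inj.ne (link.ne h), h⟩

/-- pulled back diagonals -/
def pb (p : ZMod n → ℂ) (D : Set (Sym2 ℂ)) : Set (Sym2 (ZMod n)) := {d | Sym2.map p d ∈ D}

lemma mem_pb (p : ZMod n → ℂ) (D : Set (Sym2 ℂ)) (x y : ZMod n) :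
    s(x, y) ∈ pb p D ↔ s(p x, p y) ∈ D := Iff.rfl

/-- pulled back vertex set -/
def pv (p : ZMod n → ℂ) (S : CyclicPolygon) : Finset (ZMod n) :=
  Finset.univ.filter (fun x => p x ∈ S.V)

lemma mem_pv (p : ZMod n → ℂ) (S : CyclicPolygon) (x : ZMod n) : x ∈ pv p S ↔ p x ∈ S.V := by
  simp [pv]

lemma pv_image {V : Finset ℂ} {p : ZMod n → ℂ} (hp : Enum V p) {S : CyclicPolygon}
    (hS : S.V ⊆ V) : (pv p S).image p = S.V := by
  ext z
  rw [Finset.mem_image]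
  constructor
  · rintro ⟨x, hx, rfl⟩
    exact (mem_pv _ _ _).1 hx
  · intro hz
    refine ⟨qq p z, ?_, p_qq hp (hS hz)⟩
    rw [mem_pv, p_qq hp (hS hz)]; exact hz

lemma pv_card {V : Finset ℂ} {p : ZMod n → ℂ} (hp : Enum V p) {S : CyclicPolygon}
    (hS : S.V ⊆ V) : S.V.card = (pv p S).card := by
  rw [← pv_image hp hS, Finset.card_image_of_injective _ hp.inj]

lemma edgeLength_eq {V : Finset ℂ} {p : ZMod n → ℂ} (hp : Enum V p) {S : CyclicPolygon}
    (hS : S.V ⊆ V) {u v : ZMod n} (h : u ≠ v) : edgeLength S (p u) (p v) =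
    ((pv p S).filter (fun z => 0 < (z - u).val ∧ (z - u).val < (v - u).val)).card + 1 := by
  unfold edgeLength
  have : (S.V : Set ℂ) ∩ arcOO (p u) (p v) = p '' (((pv p S).filter
      (fun z => 0 < (z - u).val ∧ (z - u).val < (v - u).val) : Finset (ZMod n)) : Set (ZMod n)) := by
    ext z
    simp only [Set.mem_inter_iff, Finset.mem_coe, arcOO, Set.mem_setOf_eq, Set.mem_image,
      Finset.mem_filter, mem_pv]
    constructor
    · rintro ⟨h1, h2, h3, h4⟩
      obtain ⟨x, rfl⟩ := (hp.rng z).1 (hS h1)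
      have h5 : x ≠ u := fun h => h2 (by rw [h])
      exact ⟨x, ⟨h1, (vpos _ _).2 h5, (hp.key _ _ _ h5 h.symm).1 h4⟩, rfl⟩
    · rintro ⟨x, ⟨h1, h2, h3⟩, rfl⟩
      have h5 : x ≠ u := (vpos _ _).1 h2
      have h6 : x ≠ v := by rintro rfl; omega
      exact ⟨h1, hp.inj.ne h5, hp.inj.ne h6, (hp.key _ _ _ h5 h.symm).2 h3⟩
  rw [this, Set.ncard_image_of_injective _ hp.inj, Set.ncard_coe_finset]

lemma diag_pb {P : CyclicPolygon} {p : ZMod n → ℂ} (hp : Enum P.V p) {D : Set (Sym2 ℂ)}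
    (hD : IsDiagonalSet P D) : IsDiag (nxP hp) (pb p D) := by
  intro x y h
  exact (linkable_iff hp x y).1 (hD _ _ h)

lemma diag_range {P : CyclicPolygon} {p : ZMod n → ℂ} (hp : Enum P.V p) {D : Set (Sym2 ℂ)}
    (hD : IsDiagonalSet P D) : D ⊆ Set.range (Sym2.map p) := by
  intro d
  induction d with
  | _ u v =>
    intro h
    have h1 := hD u v h
    refine ⟨s(qq p u, qq p v), ?_⟩
    rw [Sym2.map_mk, p_qq hp h1.2.1.1, p_qq hp h1.2.2.1]

/-- star decompositions give closed trajectories -/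
lemma good_of_decomp {P : CyclicPolygon} {p : ZMod n → ℂ} (hp : Enum P.V p) {D : Set (Sym2 ℂ)}
    (h : HasStarDecomp P D) : Good (nxP hp) (pb p D) := by
  obtain ⟨𝒮, h1, h2, h3, h4, h5, h6⟩ := h
  have hd := diag_pb hp h1
  apply good_of_stars (nxP_adm hp) hd
  intro u v huv
  obtain ⟨S, hS, hE⟩ := h4 (p u, p v) (by
    rcases huv with huv | huv
    · right; exact huv
    · left; exact (nxP_edge hp u v).2 huv)
  obtain ⟨⟨k, hk, hc, hl⟩, hV⟩ := h2 S hS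
  have hV : S.V ⊆ P.V := by exact_mod_cast hV
  refine ⟨pv p S, cn S p, cp S p, k, ?_, (mem_pv _ _ _).2 (S.endmem _ hE).2, cp_eq hp hE⟩
  constructor
  · rw [← pv_card hp hV, hc]
  · intro x hx
    rw [mem_pv] at hx ⊢
    exact (S.endmem _ (cn_edge hp hV hx)).2
  · intro x hx
    rw [mem_pv] at hx ⊢
    exact (S.endmem _ (cp_edge hp hV hx)).1
  · intro x hx
    rw [mem_pv] at hx
    exact cn_eq hp (cp_edge hp hV hx)
  · intro x hx
    rw [mem_pv] at hx
    have := hl _ (cn_edge hp hV hx)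
    rw [← edgeLength_eq hp hV (c_turn hp hV hx).2.1.symm]
    exact this
  · intro x hx
    rw [mem_pv] at hx
    exact (vpos _ _).2 (c_turn hp hV hx).2.1
  · intro x hx
    rw [mem_pv] at hx
    exact (c_turn hp hV hx).2.2
  · intro x hx
    rw [mem_pv] at hx
    rcases h3 S hS (cn_edge hp hV hx) with h | h
    · right; exact (nxP_edge hp _ _).1 h
    · left; exact h
  · intro x hx z hz hb
    rw [mem_pv] at hx
    apply h6 S hS _ _ _ (cp_edge hp hV hx) (cn_edge hp hV hx)
    have ht := c_turn hp hV hx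
    exact ⟨p z, hz, (splits_idx hp ht.1 ht.2.1 ht.2.2).2 hb⟩

lemma exists_poly {P : CyclicPolygon} {p : ZMod n → ℂ} (hp : Enum P.V p)
    {D : Set (Sym2 (ZMod n))} (hD : Good (nxP hp) D) {x : ZMod n} (hx : act (nxP hp) 0 x) :
    ∃ S : CyclicPolygon, S.V = (VS (nxP hp) D x).image p ∧
      ∀ a b, (a, b) ∈ S.E ↔ ∃ u v, Edg (nxP hp) D x u v ∧ p u = a ∧ p v = b := by
  have hn := nxP_adm hp
  let E : Finset (ℂ × ℂ) := ((Finset.univ : Finset (ZMod n × ZMod n)).filter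
    (fun e => Edg (nxP hp) D x e.1 e.2)).image (fun e => (p e.1, p e.2))
  have hE : ∀ a b, (a, b) ∈ E ↔ ∃ u v, Edg (nxP hp) D x u v ∧ p u = a ∧ p v = b := by
    intro a b
    simp only [E, Finset.mem_image, Finset.mem_filter, Finset.mem_univ, true_and, Prod.exists,
      Prod.mk.injEq]
  refine ⟨⟨(VS (nxP hp) D x).image p, E, ?_, ?_, ?_, ?_, ?_, ?_⟩, rfl, hE⟩
  · exact ⟨p x, Finset.mem_image_of_mem _ (mem_VS.2 ⟨0, rfl⟩)⟩
  · intro v hv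
    obtain ⟨z, -, rfl⟩ := Finset.mem_image.1 hv
    exact hp.nrm z
  · rintro ⟨a, b⟩ he
    obtain ⟨u, v, h1, rfl, rfl⟩ := (hE a b).1 he
    exact ⟨Finset.mem_image_of_mem _ (edg_mem h1).1, Finset.mem_image_of_mem _ (edg_mem h1).2⟩
  · intro v hv
    obtain ⟨z, hz, rfl⟩ := Finset.mem_image.1 hv
    obtain ⟨w, hw⟩ := edg_out_exists hn hD hx hz
    refine ⟨p w, (hE _ _).2 ⟨z, w, hw, rfl, rfl⟩, ?_⟩
    intro b hb
    obtain ⟨u, v, h1, h2, rfl⟩ := (hE _ _).1 hb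
    rw [hp.inj h2] at h1
    rw [edg_out_unique hn hD hx h1 hw]
  · intro v hv
    obtain ⟨z, hz, rfl⟩ := Finset.mem_image.1 hv
    obtain ⟨w, hw⟩ := edg_in hn hD hx hz
    refine ⟨p w, (hE _ _).2 ⟨w, z, hw, rfl, rfl⟩, ?_⟩
    intro b hb
    obtain ⟨u, v, h1, rfl, h2⟩ := (hE _ _).1 hb
    rw [hp.inj h2] at h1
    rw [edg_in_unique hn hD hx h1 hw]
  · intro a b c h1 h2
    obtain ⟨u, v, h3, rfl, rfl⟩ := (hE _ _).1 h1
    obtain ⟨v', w, h4, h5, rfl⟩ := (hE _ _).1 h2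
    rw [hp.inj h5] at h4
    have ht := (edg_turn hn hD hx h3 h4).1
    rw [acw_iff hp]
    have a1 : u ≠ v := (vpos _ _).1 (by omega)
    have a2 : v ≠ w := by obtain ⟨_, _, _, h⟩ := h4; exact h
    refine ⟨a1, a2, ?_, ht⟩
    rintro rfl
    omega

lemma decomp_of_good {P : CyclicPolygon} {p : ZMod n → ℂ} (hp : Enum P.V p) {D : Set (Sym2 ℂ)}
    (hr : D ⊆ Set.range (Sym2.map p)) (hD : Good (nxP hp) (pb p D)) : HasStarDecomp P D := by
  have hn := nxP_adm hp
  have : Nonempty CyclicPolygon := ⟨P⟩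
  choose! poly hV hE using fun x (hx : act (nxP hp) 0 x) => exists_poly hp hD hx
  have hsub : ∀ x, act (nxP hp) 0 x → (poly x).V ⊆ P.V := by
    intro x hx z hz
    rw [hV x hx] at hz
    obtain ⟨y, -, rfl⟩ := Finset.mem_image.1 hz
    exact p_mem hp y
  have hpv : ∀ x, act (nxP hp) 0 x → pv p (poly x) = VS (nxP hp) (pb p D) x := by
    intro x hx
    apply Finset.image_injective hp.inj
    rw [pv_image hp (hsub x hx), hV x hx]
  have hpre : ∀ a b, s(a, b) ∈ D → ∃ x y, p x = a ∧ p y = b := by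
    intro a b h
    obtain ⟨d, hd⟩ := hr h
    induction d with
    | _ x y =>
      rw [Sym2.map_mk, Sym2.eq_iff] at hd
      rcases hd with hd | hd
      · exact ⟨x, y, hd.1, hd.2⟩
      · exact ⟨y, x, hd.2, hd.1⟩
  refine ⟨(Finset.univ.filter (fun x => act (nxP hp) 0 x)).image poly, ?_, ?_, ?_, ?_, ?_, ?_⟩
  · intro u v h
    obtain ⟨x, y, rfl, rfl⟩ := hpre u v h
    exact (linkable_iff hp x y).2 (hD.1 x y h)
  · intro S hS
    obtain ⟨x, hx, rfl⟩ := Finset.mem_image.1 hS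
    have hx := (Finset.mem_filter.1 hx).2
    refine ⟨?_, by exact_mod_cast hsub x hx⟩
    obtain ⟨v0, hv0⟩ := edg_out_exists hn hD hx (mem_VS.2 ⟨0, rfl⟩)
    obtain ⟨c, hc0⟩ : ∃ c, (VS (nxP hp) (pb p D) x).card = 2 * (c + 1) + 1 :=
      ⟨_, edg_count hn hD hx hv0⟩
    refine ⟨c + 1, Nat.succ_pos _, (pv_card hp (hsub x hx)).trans ?_, ?_⟩
    · rw [hpv x hx]; exact hc0
    · rintro ⟨a, b⟩ he
      obtain ⟨u, v, h1, rfl, rfl⟩ := (hE x hx a b).1 he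
      have hc := edg_count hn hD hx h1
      have huv : u ≠ v := by obtain ⟨_, _, _, h⟩ := h1; exact h
      rw [edgeLength_eq hp (hsub x hx) huv, hpv x hx]
      omega
  · intro S hS
    obtain ⟨x, hx, rfl⟩ := Finset.mem_image.1 hS
    have hx := (Finset.mem_filter.1 hx).2
    rintro ⟨a, b⟩ he
    obtain ⟨u, v, h1, rfl, rfl⟩ := (hE x hx a b).1 he
    rcases edg_kind hn hD hx h1 with h | h
    · right; exact h
    · left; exact (nxP_edge hp u v).2 h
  · rintro ⟨a, b⟩ he
    have : ∃ u v, p u = a ∧ p v = b ∧ (s(u, v) ∈ pb p D ∨ nxP hp u = v) := by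
      rcases he with he | he
      · have h1 := P.endmem _ he
        refine ⟨qq p a, qq p b, p_qq hp h1.1, p_qq hp h1.2, Or.inr ?_⟩
        rw [← nxP_edge, p_qq hp h1.1, p_qq hp h1.2]; exact he
      · obtain ⟨x, y, rfl, rfl⟩ := hpre a b he
        exact ⟨x, y, rfl, rfl, Or.inl he⟩
    obtain ⟨u, v, rfl, rfl, huv⟩ := this
    obtain ⟨x, hx, h⟩ := edg_exists hn hD huv
    refine ⟨poly x, Finset.mem_image_of_mem _ (by simpa using hx), ?_⟩
    exact (hE x hx _ _).2 ⟨u, v, h, rfl, rfl⟩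
  · intro S1 hS1 S2 hS2 hne
    obtain ⟨x, hx, rfl⟩ := Finset.mem_image.1 hS1
    have hx := (Finset.mem_filter.1 hx).2
    obtain ⟨y, hy, rfl⟩ := Finset.mem_image.1 hS2
    have hy := (Finset.mem_filter.1 hy).2
    rintro ⟨a, b⟩ h1 h2
    obtain ⟨u, v, h3, rfl, rfl⟩ := (hE x hx a b).1 h1
    obtain ⟨u', v', h4, h5, h6⟩ := (hE y hy _ _).1 h2
    rw [hp.inj h5, hp.inj h6] at h4
    exact hne (by rw [edg_inj hn hD hx hy h3 h4])
  · intro S hS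
    obtain ⟨x, hx, rfl⟩ := Finset.mem_image.1 hS
    have hx := (Finset.mem_filter.1 hx).2
    rintro a b c h1 h2 ⟨z, hz1, hz2⟩
    obtain ⟨u, v, h3, rfl, rfl⟩ := (hE x hx _ _).1 h1
    obtain ⟨v', w, h4, h5, rfl⟩ := (hE x hx _ _).1 h2
    rw [hp.inj h5] at h4
    obtain ⟨v'', y, -, rfl⟩ := hpre _ _ hz1
    have ht := edg_turn hn hD hx h3 h4
    have a1 : u ≠ v := by obtain ⟨_, _, _, h⟩ := h3; exact h
    have a2 : v ≠ w := by obtain ⟨_, _, _, h⟩ := h4; exact h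
    exact ht.2 y hz1 ((splits_idx hp a1 a2.symm ht.1).1 hz2)

lemma decomp_iff {P : CyclicPolygon} {p : ZMod n → ℂ} (hp : Enum P.V p) (D : Set (Sym2 ℂ)) :
    HasStarDecomp P D ↔ D ⊆ Set.range (Sym2.map p) ∧ Good (nxP hp) (pb p D) := by
  constructor
  · intro h
    refine ⟨?_, good_of_decomp hp h⟩
    obtain ⟨𝒮, h1, -⟩ := h
    exact diag_range hp h1
  · rintro ⟨h1, h2⟩
    exact decomp_of_good hp h1 h2

end SD

/-- If `𝒮` is a maximal star decomposition of a cyclic polygon `P` with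
respect to a set of diagonals `D`, then for every diagonal `e ∈ D` there exists exactly one
diagonal `f ∉ D` such that `P` has a maximal star decomposition with respect to
`(D \ {e}) ∪ {f}`. -/
theorem flip_uniqueness (P : CyclicPolygon) (D : Set (Sym2 ℂ)) (𝒮 : Finset CyclicPolygon)
    (h : IsMaximalStarDecomp P D 𝒮) :
    ∀ e ∈ D, ∃! f : Sym2 ℂ, f ∉ D ∧
      ∃ 𝒮' : Finset CyclicPolygon, IsMaximalStarDecomp P ((D \ {e}) ∪ {f}) 𝒮' := by
  intro e he
  have : NeZero P.V.card := ⟨(Finset.card_pos.2 P.nonempty).ne'⟩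
  obtain ⟨p, hp⟩ := SD.exists_enum (n := P.V.card) P.V P.onCircle rfl
  have hinj : Function.Injective (Sym2.map p) := Sym2.map.injective hp.inj
  -- images and preimages
  have himg : ∀ D0 : Set (Sym2 (ZMod P.V.card)), SD.pb p (Sym2.map p '' D0) = D0 := fun D0 =>
    Set.preimage_image_eq D0 hinj
  have hpbi : ∀ D' : Set (Sym2 ℂ), D' ⊆ Set.range (Sym2.map p) → Sym2.map p '' SD.pb p D' = D' :=
    fun D' h => Set.image_preimage_eq_of_subset h
  have hmaxiff : ∀ D' : Set (Sym2 ℂ), (∃ 𝒮' : Finset CyclicPolygon, IsMaximalStarDecomp P D' 𝒮') ↔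
      D' ⊆ Set.range (Sym2.map p) ∧ SD.Good (SD.nxP hp) (SD.pb p D') ∧
        ∀ D0, SD.pb p D' ⊂ D0 → ¬ SD.Good (SD.nxP hp) D0 := by
    intro D'
    constructor
    · rintro ⟨𝒮', h1, h2⟩
      have h3 := (SD.decomp_iff hp D').1 ⟨𝒮', h1⟩
      refine ⟨h3.1, h3.2, ?_⟩
      intro D0 hD0 hg
      apply h2 (Sym2.map p '' D0)
      · rw [← hpbi D' h3.1]
        exact ⟨Set.image_mono hD0.1, fun hh => hD0.2 ((Set.image_subset_image_iff hinj).1 hh)⟩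
      · rw [SD.decomp_iff hp, himg]
        exact ⟨Set.image_subset_range _ _, hg⟩
    · rintro ⟨h1, h2, h3⟩
      obtain ⟨𝒮', h4⟩ := (SD.decomp_iff hp D').2 ⟨h1, h2⟩
      refine ⟨𝒮', h4, ?_⟩
      intro D'' hD'' hd
      obtain ⟨h5, h6⟩ := (SD.decomp_iff hp D'').1 hd
      apply h3 _ _ h6
      rw [← hpbi D' h1, ← hpbi D'' h5] at hD''
      exact ⟨(Set.image_subset_image_iff hinj).1 hD''.1, fun hh => hD''.2 (Set.image_mono hh)⟩
  obtain ⟨hr, hg, hm⟩ := (hmaxiff D).1 ⟨𝒮, h⟩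
  obtain ⟨e0, rfl⟩ := hr he
  have hpbf : ∀ f0, SD.pb p ((D \ {Sym2.map p e0}) ∪ {Sym2.map p f0}) =
      (SD.pb p D \ {e0}) ∪ {f0} := by
    intro f0
    ext d
    simp only [SD.pb, Set.mem_setOf_eq, Set.mem_union, Set.mem_diff, Set.mem_singleton_iff,
      hinj.eq_iff]
  obtain ⟨f0, ⟨hf1, hf2, hf3⟩, hu⟩ := SD.comb_main (SD.nxP_adm hp) hg hm e0 he
  refine ⟨Sym2.map p f0, ⟨hf1, ?_⟩, ?_⟩
  · rw [hmaxiff, hpbf]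
    refine ⟨?_, hf2, hf3⟩
    apply Set.union_subset (Set.diff_subset.trans hr)
    rintro _ rfl
    exact ⟨f0, rfl⟩
  · rintro f ⟨h1, h2⟩
    rw [hmaxiff] at h2
    obtain ⟨k1, k2, k3⟩ := h2
    obtain ⟨f1, rfl⟩ := k1 (Or.inr rfl)
    rw [hpbf] at k2 k3
    rw [hu f1 ⟨h1, k2, k3⟩]


end
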